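/- For functions f, g, h on ℝ one has the paraproduct estimate ‖ |∇|^{-1/8}(fgh) ‖_{L^{4/3}(ℝ)} ≲ ‖ |∇|^{-1/8} f ‖_{L²(ℝ)} · ‖ |∇|^{3/8} g ‖_{L²(ℝ)} · ‖ |∇|^{3/8} h ‖_{L²(ℝ)}. -/

import Mathlib

open MeasureTheory Real

/-- Fourier transform with convention `f̂(ξ) = ∫ f(x) e^{-ixξ} dx`. -/
noncomputable def FT (f : ℝ → ℂ) (ξ : ℝ) : ℂ :=
  ∫ x : ℝ, f x * Complex.exp (-(Complex.I * x * ξ))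

/-- The Fourier multiplier operator `|∇|^s`, with symbol `|ξ|^s`, realized via
Fourier inversion. -/
noncomputable def absGrad (s : ℝ) (f : ℝ → ℂ) (x : ℝ) : ℂ :=
  (2 * π)⁻¹ • ∫ ξ : ℝ, (|ξ| ^ s : ℝ) • (FT f ξ * Complex.exp (Complex.I * x * ξ))

open scoped ENNReal NNReal

lemma PP_lint_abs (φ : ℝ → ℝ≥0∞) (x : ℝ) :
    ∫⁻ y, φ |x - y| = 2 * ∫⁻ t in Set.Ioi (0:ℝ), φ t := by
  have h1 : ∫⁻ y, φ |x - y| = ∫⁻ y, φ |y| :=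
    lintegral_sub_left_eq_self (fun y => φ |y|) x
  have h2 : ∫⁻ t in Set.Iio (0:ℝ), φ |t| = ∫⁻ t in Set.Ioi (0:ℝ), φ |t| := by
    have := (Measure.measurePreserving_neg (volume : Measure ℝ)).setLIntegral_comp_emb
      (MeasurableEquiv.neg ℝ).measurableEmbedding (fun t => φ |t|) (Set.Iio (0:ℝ))
    rw [Set.image_neg_eq_neg, Set.neg_Iio, neg_zero] at this
    rw [← this]; simp
  rw [h1, ← lintegral_add_compl _ (measurableSet_Iio (a := (0:ℝ))), Set.compl_Iio, h2,
    setLIntegral_congr Ioi_ae_eq_Ici.symm, two_mul]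
  have h3 : ∫⁻ t in Set.Ioi (0:ℝ), φ |t| = ∫⁻ t in Set.Ioi (0:ℝ), φ t :=
    setLIntegral_congr_fun measurableSet_Ioi (fun t ht => by simp [abs_of_pos ht.out])
  rw [h3]

/-- near part of the kernel -/
lemma PP_near {α : ℝ} (hα : 0 < α) (R : ℝ) (hR : 0 < R) (x : ℝ) :
    ∫⁻ y, (if |x - y| < R then ENNReal.ofReal (|x - y| ^ (α - 1)) else 0)
      = ENNReal.ofReal (2 / α * R ^ α) := by
  have h0 := PP_lint_abs (fun t => if t < R then ENNReal.ofReal (t ^ (α - 1)) else 0) x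
  rw [h0]
  have h1 : ∫⁻ t in Set.Ioi (0:ℝ), (if t < R then ENNReal.ofReal (t ^ (α - 1)) else 0)
      = ∫⁻ t in Set.Ioo 0 R, ENNReal.ofReal (t ^ (α - 1)) := by
    have : (fun t => if t < R then ENNReal.ofReal (t ^ (α - 1)) else 0)
      = (Set.Iio R).indicator (fun t => ENNReal.ofReal (t ^ (α - 1))) := by
      ext t; simp [Set.indicator]
    rw [this, lintegral_indicator measurableSet_Iio, Measure.restrict_restrict measurableSet_Iio]
    congr 2; ext t; simp; tauto
  have hint : IntegrableOn (fun t : ℝ => t ^ (α - 1)) (Set.Ioc 0 R) :=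
    (intervalIntegrable_iff_integrableOn_Ioc_of_le hR.le).1
      (intervalIntegral.intervalIntegrable_rpow' (by linarith))
  rw [h1, setLIntegral_congr Ioo_ae_eq_Ioc, ← ofReal_integral_eq_lintegral_ofReal hint,
    ← intervalIntegral.integral_of_le hR.le, integral_rpow (Or.inl (by linarith)),
    show (2:ℝ≥0∞) = ENNReal.ofReal 2 by simp, ← ENNReal.ofReal_mul (by norm_num)]
  · congr 1
    rw [sub_add_cancel, Real.zero_rpow hα.ne']; ring
  · filter_upwards [ae_restrict_mem measurableSet_Ioc] with t ht
    exact Real.rpow_nonneg ht.1.le _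

lemma PP_far {γ : ℝ} (hγ : 1 < γ) (R : ℝ) (hR : 0 < R) (x : ℝ) :
    ∫⁻ y, (if |x - y| < R then 0 else ENNReal.ofReal (|x - y| ^ (-γ)))
      = ENNReal.ofReal (2 / (γ - 1) * R ^ (1 - γ)) := by
  have h0 := PP_lint_abs (fun t => if t < R then 0 else ENNReal.ofReal (t ^ (-γ))) x
  rw [h0]
  have h1 : ∫⁻ t in Set.Ioi (0:ℝ), (if t < R then 0 else ENNReal.ofReal (t ^ (-γ)))
      = ∫⁻ t in Set.Ici R, ENNReal.ofReal (t ^ (-γ)) := by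
    have : (fun t => if t < R then 0 else ENNReal.ofReal (t ^ (-γ)))
      = (Set.Ici R).indicator (fun t => ENNReal.ofReal (t ^ (-γ))) := by
      ext t; by_cases h : t < R <;> simp [Set.indicator, h]
    rw [this, lintegral_indicator measurableSet_Ici, Measure.restrict_restrict measurableSet_Ici]
    congr 2; ext t; simp; intro h; linarith
  have hint : IntegrableOn (fun t : ℝ => t ^ (-γ)) (Set.Ioi R) :=
    integrableOn_Ioi_rpow_of_lt (by linarith) hR
  rw [h1, ← setLIntegral_congr Ioi_ae_eq_Ici, ← ofReal_integral_eq_lintegral_ofReal hint,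
    integral_Ioi_rpow_of_lt (by linarith) hR,
    show (2:ℝ≥0∞) = ENNReal.ofReal 2 by simp, ← ENNReal.ofReal_mul (by norm_num)]
  · congr 1
    have : -γ + 1 ≠ 0 := by linarith
    have : γ - 1 ≠ 0 := by linarith
    rw [show 1 - γ = -γ + 1 by ring]
    rw [show -γ + 1 = - (γ - 1) by ring]
    field_simp
  · filter_upwards [ae_restrict_mem measurableSet_Ioi] with t ht
    exact Real.rpow_nonneg (hR.le.trans ht.out.le) _

/-- Riesz potential (unnormalized) of a nonnegative function. -/
noncomputable def RI (α : ℝ) (u : ℝ → ℝ≥0∞) (x : ℝ) : ℝ≥0∞ :=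
  ∫⁻ y, ENNReal.ofReal (|x - y| ^ (α - 1)) * u y

lemma RI_core {α r : ℝ} (hα : 0 < α) (hα1 : α < 1) (hr : 1 < r) (hαr : α * r < 1) :
    ∃ C : ℝ≥0, 0 < C ∧ ∀ h : ℝ → ℝ≥0∞, Measurable h → ∀ B : ℝ≥0∞, (∀ y, h y ≤ B) →
      ∫⁻ y, h y ^ r ≤ 1 → ∀ x, RI α h x ≤ C * B ^ (1 - r * α) := by
  set r' := r / (r - 1) with hr'
  have hr1 : 0 < r - 1 := by linarith
  have hconj : r'.HolderConjugate r := (Real.HolderConjugate.conjExponent hr).symm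
  have hr'0 : 0 < r' := by positivity
  set γ := (1 - α) * r' with hγ
  have hγ1 : 1 < γ := by
    rw [hγ, hr', ← mul_div_assoc, lt_div_iff₀ hr1]; nlinarith
  set C2 : ℝ := (2 / (γ - 1)) ^ (1 / r') with hC2
  have hg1 : 0 < γ - 1 := by linarith
  have hC2p : 0 < C2 := by positivity
  refine ⟨Real.toNNReal (2 / α + C2), by simp; positivity, ?_⟩
  intro h hm B hB hint x
  rcases eq_or_ne B 0 with rfl | hB0
  · have : RI α h x = 0 := by simp [RI, fun y => le_antisymm (hB y) bot_le]
    rw [this]; exact bot_le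
  have hexp : 0 < 1 - r * α := by linarith [mul_comm α r]
  rcases eq_or_ne B ⊤ with rfl | hBt
  · rw [ENNReal.top_rpow_of_pos hexp, ENNReal.mul_top]
    · exact le_top
    · have : 0 < 2 / α + C2 := by positivity
      simpa using this
  obtain ⟨b, rfl⟩ : ∃ b : ℝ≥0, B = b := ⟨B.toNNReal, (ENNReal.coe_toNNReal hBt).symm⟩
  have hb : (0:ℝ) < b := by
    have : b ≠ 0 := by simpa using hB0
    exact_mod_cast pos_iff_ne_zero.2 this
  set R : ℝ := (b:ℝ) ^ (-r) with hR
  have hRp : 0 < R := Real.rpow_pos_of_pos hb _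
  set k1 : ℝ → ℝ≥0∞ := fun y => if |x - y| < R then ENNReal.ofReal (|x - y| ^ (α - 1)) else 0
  set k2 : ℝ → ℝ≥0∞ := fun y => if |x - y| < R then 0 else ENNReal.ofReal (|x - y| ^ (α - 1))
  have hms : MeasurableSet {y : ℝ | |x - y| < R} := measurableSet_lt (by fun_prop) (by fun_prop)
  have hk1 : Measurable k1 := Measurable.ite hms (by fun_prop) (by fun_prop)
  have hk2 : Measurable k2 := Measurable.ite hms (by fun_prop) (by fun_prop)
  have e1 : RI α h x = (∫⁻ y, k1 y * h y) + ∫⁻ y, k2 y * h y := by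
    rw [← lintegral_add_left (f := fun y => k1 y * h y) (hk1.mul hm)]
    unfold RI
    congr 1; ext y
    by_cases hy : |x - y| < R <;> simp [k1, k2, hy]
  have n1 : ∫⁻ y, k1 y * h y ≤ ENNReal.ofReal (2 / α * b ^ (1 - r * α)) := by
    calc ∫⁻ y, k1 y * h y ≤ ∫⁻ y, k1 y * b := by gcongr with y; exact hB y
      _ = ENNReal.ofReal (2 / α * R ^ α) * b := by
        rw [lintegral_mul_const _ hk1, PP_near hα R hRp x]
      _ = _ := by
        rw [show (b:ℝ≥0∞) = ENNReal.ofReal b by simp, ← ENNReal.ofReal_mul (by positivity)]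
        congr 1
        rw [hR, ← Real.rpow_mul hb.le, sub_eq_add_neg, Real.rpow_add hb, Real.rpow_one]
        ring_nf
  have n2 : ∫⁻ y, k2 y * h y ≤ ENNReal.ofReal (C2 * b ^ (1 - r * α)) := by
    calc ∫⁻ y, k2 y * h y ≤ (∫⁻ y, k2 y ^ r') ^ (1 / r') * (∫⁻ y, h y ^ r) ^ (1 / r) :=
          ENNReal.lintegral_mul_le_Lp_mul_Lq _ hconj hk2.aemeasurable hm.aemeasurable
      _ ≤ (∫⁻ y, k2 y ^ r') ^ (1 / r') * 1 := by
          gcongr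
          exact ENNReal.rpow_le_one hint (by positivity)
      _ = (ENNReal.ofReal (2 / (γ - 1) * R ^ (1 - γ))) ^ (1 / r') := by
          rw [mul_one, ← PP_far hγ1 R hRp x]
          congr 2; ext y
          by_cases hy : |x - y| < R
          · simp [k2, hy, hr'0]
          · simp only [k2, hy, if_false]
            rw [ENNReal.ofReal_rpow_of_nonneg (by positivity) hr'0.le,
              ← Real.rpow_mul (abs_nonneg _)]
            congr 2; rw [hγ]; ring
      _ = _ := by
          rw [ENNReal.ofReal_rpow_of_nonneg (by positivity) (by positivity),
            Real.mul_rpow (by positivity) (by positivity), ← hC2]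
          congr 2
          rw [hR, ← Real.rpow_mul hb.le, ← Real.rpow_mul hb.le]
          congr 1
          rw [hγ, hr']; field_simp; ring
  rw [e1]
  refine (add_le_add n1 n2).trans (le_of_eq ?_)
  rw [← ENNReal.ofReal_add (by positivity) (by positivity), ← add_mul,
    ENNReal.ofReal_mul (by positivity)]
  congr 1
  rw [← ENNReal.ofReal_rpow_of_pos hb]; simp

lemma RI_kernel_meas (α : ℝ) :
    Measurable (fun z : ℝ × ℝ => ENNReal.ofReal (|z.1 - z.2| ^ (α - 1))) := by
  fun_prop

lemma RI_meas (α : ℝ) {u : ℝ → ℝ≥0∞} (hu : Measurable u) : Measurable (RI α u) := by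
  unfold RI
  exact Measurable.lintegral_prod_right'
    (f := fun z : ℝ × ℝ => ENNReal.ofReal (|z.1 - z.2| ^ (α - 1)) * u z.2)
    ((RI_kernel_meas α).mul (hu.comp measurable_snd))

/-- half of the bilinear HLS form -/
lemma HLS_half {α p r : ℝ} (hα : 0 < α) (hα1 : α < 1) (hp : 1 < p) (hr : 1 < r)
    (hαr : α * r < 1) (hpr : 1 / p + 1 / r = 1 + α) :
    ∃ C : ℝ≥0, 0 < C ∧ ∀ f h : ℝ → ℝ≥0∞, Measurable f → Measurable h →
      ∫⁻ x, f x ^ p ≤ 1 → ∫⁻ y, h y ^ r ≤ 1 →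
      ∀ S : Set (ℝ × ℝ), MeasurableSet S → (∀ x y, (x, y) ∈ S → h y ^ r ≤ f x ^ p) →
      ∫⁻ x, ∫⁻ y, S.indicator (fun z => f z.1 * (ENNReal.ofReal (|z.1 - z.2| ^ (α - 1)) * h z.2))
        (x, y) ≤ C := by
  obtain ⟨C, hC, H⟩ := RI_core hα hα1 hr hαr
  refine ⟨C, hC, fun f h hf hh hfi hhi S hS hSle => ?_⟩
  have hp0 : 0 < p := by linarith
  have hr0 : 0 < r := by linarith
  have key : ∀ x, ∫⁻ y, S.indicator
      (fun z => f z.1 * (ENNReal.ofReal (|z.1 - z.2| ^ (α - 1)) * h z.2)) (x, y)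
      ≤ C * f x ^ p := by
    intro x
    set Sx : Set ℝ := (fun y => (x, y)) ⁻¹' S
    have hSx : MeasurableSet Sx := hS.preimage (by fun_prop)
    set h' : ℝ → ℝ≥0∞ := Sx.indicator h
    have hh' : Measurable h' := hh.indicator hSx
    have e : ∀ y, S.indicator
        (fun z => f z.1 * (ENNReal.ofReal (|z.1 - z.2| ^ (α - 1)) * h z.2)) (x, y)
        = f x * (ENNReal.ofReal (|x - y| ^ (α - 1)) * h' y) := by
      intro y
      by_cases hy : (x, y) ∈ S
      · have : y ∈ Sx := hy
        simp [h', hy, this]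
      · have : y ∉ Sx := hy
        simp [h', hy, this]
    simp_rw [e]
    rw [lintegral_const_mul _ (by fun_prop)]
    have b1 : ∀ y, h' y ≤ f x ^ (p / r) := by
      intro y
      by_cases hy : y ∈ Sx
      · have h1 := hSle x y hy
        simp only [h', Set.indicator_of_mem hy]
        have := ENNReal.rpow_le_rpow h1 (z := 1 / r) (by positivity)
        rw [← ENNReal.rpow_mul, ← ENNReal.rpow_mul] at this
        simpa [hr0.ne', div_eq_mul_inv] using this
      · simp [h', hy]
    have b2 : ∫⁻ y, h' y ^ r ≤ 1 := by
      refine le_trans ?_ hhi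
      gcongr with y
      exact Set.indicator_le_self _ _ _
    have := H h' hh' _ b1 b2 x
    rw [← ENNReal.rpow_mul] at this
    have ex : p / r * (1 - r * α) = p - 1 := by
      have : 1 / r - α = 1 - 1 / p := by linarith
      calc p / r * (1 - r * α) = p * (1 / r - α) := by field_simp
        _ = _ := by rw [this]; field_simp
    rw [ex] at this
    calc f x * ∫⁻ y, ENNReal.ofReal (|x - y| ^ (α - 1)) * h' y
        ≤ f x * (C * f x ^ (p - 1)) := by gcongr; exact this
      _ = C * (f x ^ (1:ℝ) * f x ^ (p - 1)) := by rw [ENNReal.rpow_one]; ring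
      _ = C * f x ^ p := by
        rw [← ENNReal.rpow_add_of_nonneg _ _ (by norm_num) (by linarith)]; ring_nf
  calc _ ≤ ∫⁻ x, C * f x ^ p := lintegral_mono key
    _ = C * ∫⁻ x, f x ^ p := lintegral_const_mul _ (by fun_prop)
    _ ≤ C * 1 := by gcongr
    _ = C := mul_one _

lemma HLS_bilin {α p r : ℝ} (hα : 0 < α) (hα1 : α < 1) (hp : 1 < p) (hr : 1 < r)
    (hpr : 1 / p + 1 / r = 1 + α) :
    ∃ C : ℝ≥0, 0 < C ∧ ∀ f h : ℝ → ℝ≥0∞, Measurable f → Measurable h →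
      ∫⁻ x, f x ^ p ≤ 1 → ∫⁻ y, h y ^ r ≤ 1 → ∫⁻ x, f x * RI α h x ≤ C := by
  have hp1 : 1 / p < 1 := by rw [div_lt_one] <;> linarith
  have hr1 : 1 / r < 1 := by rw [div_lt_one] <;> linarith
  have hαr : α * r < 1 := by rw [← lt_div_iff₀ (by linarith)]; linarith
  have hαp : α * p < 1 := by rw [← lt_div_iff₀ (by linarith)]; linarith
  obtain ⟨C1, hC1, H1⟩ := HLS_half hα hα1 hp hr hαr hpr
  obtain ⟨C2, hC2, H2⟩ := HLS_half hα hα1 hr hp hαp (by linarith)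
  refine ⟨C1 + C2, by positivity, fun f h hf hh hfi hhi => ?_⟩
  set S : Set (ℝ × ℝ) := {z | h z.2 ^ r ≤ f z.1 ^ p} with hSdef
  have hS : MeasurableSet S := measurableSet_le (by fun_prop) (by fun_prop)
  set T : Set (ℝ × ℝ) := {z | f z.2 ^ p < h z.1 ^ r} with hTdef
  have hT : MeasurableSet T := measurableSet_lt (by fun_prop) (by fun_prop)
  set Φ : ℝ × ℝ → ℝ≥0∞ := fun z => f z.1 * (ENNReal.ofReal (|z.1 - z.2| ^ (α - 1)) * h z.2)
  set Ψ : ℝ × ℝ → ℝ≥0∞ := fun z => h z.1 * (ENNReal.ofReal (|z.1 - z.2| ^ (α - 1)) * f z.2)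
  have hΦ : Measurable Φ := by fun_prop
  have hΨ : Measurable Ψ := by fun_prop
  have e : ∀ x, f x * RI α h x
      = (∫⁻ y, S.indicator Φ (x, y)) + ∫⁻ y, T.indicator Ψ (y, x) := by
    intro x
    unfold RI
    rw [← lintegral_const_mul _ (by fun_prop), ← lintegral_add_left
      (f := fun y => S.indicator Φ (x, y)) ((hΦ.indicator hS).comp measurable_prodMk_left)]
    congr 1; ext y
    by_cases hy : h y ^ r ≤ f x ^ p
    · have h1 : (x, y) ∈ S := hy
      have h2 : (y, x) ∉ T := not_lt.2 hy
      simp [h1, h2, Φ]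
    · have h1 : (x, y) ∉ S := hy
      have h2 : (y, x) ∈ T := not_le.1 hy
      simp only [h1, h2, Ψ, Set.indicator_of_notMem, Set.indicator_of_mem, not_false_eq_true,
        zero_add]
      rw [abs_sub_comm]; ring
  simp_rw [e]
  rw [lintegral_add_left]
  · push_cast
    refine add_le_add (H1 f h hf hh hfi hhi S hS (fun x y h => h)) ?_
    rw [lintegral_lintegral_swap]
    · exact H2 h f hh hf hhi hfi T hT (fun x y h => h.out.le)
    · exact ((hΨ.indicator hT).comp measurable_swap).aemeasurable
  · exact Measurable.lintegral_prod_right' (f := S.indicator Φ) (hΦ.indicator hS)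

/-- the `L^p` norm of a nonnegative function -/
noncomputable def NN (p : ℝ) (u : ℝ → ℝ≥0∞) : ℝ≥0∞ := (∫⁻ x, u x ^ p) ^ (1 / p)

lemma dual_aux {q : ℝ} (hq : 1 < q) {u : ℝ → ℝ≥0∞} (hu : Measurable u) (C : ℝ≥0∞)
    (H : ∀ h : ℝ → ℝ≥0∞, Measurable h → ∫⁻ y, h y ^ (q / (q - 1)) ≤ 1 → ∫⁻ x, h x * u x ≤ C) :
    NN q u ≤ C := by
  have hq1 : 0 < q - 1 := by linarith
  have hq0 : 0 < q := by linarith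
  set v : ℕ → ℝ → ℝ≥0∞ := fun n x => (Set.Icc (-(n:ℝ)) n).indicator (fun x => min (u x) n) x
  have hv : ∀ n, Measurable (v n) := fun n => (hu.min measurable_const).indicator measurableSet_Icc
  have hvu : ∀ n x, v n x ≤ u x := by
    intro n x
    by_cases hx : x ∈ Set.Icc (-(n:ℝ)) n 
    · simp only [v, Set.indicator_of_mem hx]; exact min_le_left _ _
    · simp [v, hx]
  have hvmono : Monotone v := by
    intro n m hnm x
    have hnm' : (n:ℝ) ≤ m := by exact_mod_cast hnm
    by_cases hx : x ∈ Set.Icc (-(n:ℝ)) n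
    · have hx' : x ∈ Set.Icc (-(m:ℝ)) m := ⟨by linarith [hx.1], by linarith [hx.2]⟩
      simp only [v, Set.indicator_of_mem hx, Set.indicator_of_mem hx']
      gcongr
    · simp [v, hx]
  have hfin : ∀ n, ∫⁻ x, v n x ^ q ≠ ⊤ := by
    intro n
    have : ∫⁻ x, v n x ^ q ≤ ∫⁻ x, (Set.Icc (-(n:ℝ)) n).indicator (fun _ => (n:ℝ≥0∞) ^ q) x := by
      gcongr with x
      by_cases hx : x ∈ Set.Icc (-(n:ℝ)) n
      · simp only [v, Set.indicator_of_mem hx]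
        gcongr; exact min_le_right _ _
      · simp [v, hx, hq0]
    refine ne_top_of_le_ne_top ?_ this
    rw [lintegral_indicator measurableSet_Icc]
    simp only [lintegral_const, Measure.restrict_apply MeasurableSet.univ, Set.univ_inter,
      Real.volume_Icc]
    exact ENNReal.mul_ne_top (by simp [hq0.le]) (by simp)
  have hb : ∀ n, (∫⁻ x, v n x ^ q) ≤ C ^ q := by
    intro n
    set N := ∫⁻ x, v n x ^ q with hN
    rcases eq_or_ne N 0 with h0 | h0
    · rw [h0]; exact bot_le
    set c : ℝ≥0∞ := N ^ (-(1 - 1 / q)) with hc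
    have h1 := H (fun x => c * v n x ^ (q - 1)) (by fun_prop) (by
      have : ∀ y, (c * v n y ^ (q - 1)) ^ (q / (q - 1)) = N⁻¹ * v n y ^ q := by
        intro y
        rw [ENNReal.mul_rpow_of_nonneg _ _ (by positivity), hc, ← ENNReal.rpow_mul,
          ← ENNReal.rpow_mul, ← ENNReal.rpow_neg_one]
        congr 2 <;> field_simp
      simp_rw [this]
      rw [lintegral_const_mul _ (by fun_prop), ← hN, ENNReal.inv_mul_cancel h0 (hfin n)])
    have h2 : c * N ≤ C := by
      refine le_trans ?_ h1
      rw [hN, ← lintegral_const_mul _ (by fun_prop)]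
      refine lintegral_mono fun x => ?_
      simp only []
      rw [mul_assoc]
      refine mul_le_mul_right ?_ c
      calc v n x ^ q = v n x ^ (q - 1) * v n x ^ (1:ℝ) := by
            rw [← ENNReal.rpow_add_of_nonneg _ _ (by linarith) (by norm_num)]; ring_nf
        _ ≤ _ := by rw [ENNReal.rpow_one]; gcongr; exact hvu n x
    have h3 : c * N = N ^ (1 / q) := by
      calc c * N = N ^ (-(1 - 1 / q)) * N ^ (1:ℝ) := by rw [hc, ENNReal.rpow_one]
        _ = _ := by rw [← ENNReal.rpow_add _ _ h0 (hfin n)]; ring_nf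
    rw [h3] at h2
    have := ENNReal.rpow_le_rpow h2 hq0.le
    rwa [← ENNReal.rpow_mul, one_div_mul_cancel hq0.ne', ENNReal.rpow_one] at this
  have hlim : ∫⁻ x, u x ^ q = ⨆ n, ∫⁻ x, v n x ^ q := by
    rw [← lintegral_iSup (fun n => by fun_prop)
      (fun n m h x => ENNReal.rpow_le_rpow (hvmono h x) hq0.le)]
    congr 1; ext x
    apply le_antisymm
    · rcases eq_or_ne (u x) ⊤ with ht | ht
      · rw [ht, ENNReal.top_rpow_of_pos hq0, top_le_iff, iSup_eq_top]
        intro b hb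
        obtain ⟨n, hn⟩ := ENNReal.exists_nat_gt (r := max b (ENNReal.ofReal |x|) + 1)
          (by simp [hb.ne])
        refine ⟨n, ?_⟩
        have hx : x ∈ Set.Icc (-(n:ℝ)) n := by
          have : ENNReal.ofReal |x| ≤ n := (le_max_right b _).trans (le_self_add.trans hn.le)
          rw [ENNReal.ofReal_le_natCast] at this
          exact abs_le.1 this
        have : v n x = n := by simp only [v, Set.indicator_of_mem hx, ht]; simp
        rw [this]
        have h1n : (1:ℝ≥0∞) ≤ n := le_add_self.trans hn.le
        calc b < (n:ℝ≥0∞) := lt_of_le_of_lt ((le_max_left b _).trans le_self_add) hn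
          _ = (n:ℝ≥0∞) ^ (1:ℝ) := by simp
          _ ≤ _ := ENNReal.rpow_le_rpow_of_exponent_le h1n hq.le
      · obtain ⟨n, hn⟩ := ENNReal.exists_nat_gt (r := max (u x) (ENNReal.ofReal |x|)) (by simp [ht])
        refine le_iSup_of_le n ?_
        have hx : x ∈ Set.Icc (-(n:ℝ)) n := by
          have : ENNReal.ofReal |x| ≤ n := (le_max_right _ _).trans hn.le
          rw [ENNReal.ofReal_le_natCast] at this
          exact abs_le.1 this
        have : v n x = u x := by
          simp only [v, Set.indicator_of_mem hx]
          exact min_eq_left ((le_max_left _ _).trans hn.le)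
        rw [this]
    · exact iSup_le fun n => ENNReal.rpow_le_rpow (hvu n x) hq0.le
  unfold NN
  rw [hlim]
  calc (⨆ n, ∫⁻ x, v n x ^ q) ^ (1 / q) ≤ (C ^ q) ^ (1 / q) := by
        gcongr; exact iSup_le hb
    _ = C := by rw [← ENNReal.rpow_mul, mul_one_div_cancel hq0.ne', ENNReal.rpow_one]

lemma RI_const_mul (α : ℝ) (c : ℝ≥0∞) {u : ℝ → ℝ≥0∞} (hu : Measurable u) (x : ℝ) :
    RI α (fun y => c * u y) x = c * RI α u x := by
  unfold RI
  rw [← lintegral_const_mul _ (by fun_prop)]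
  congr 1; ext y; ring

lemma NN_const_mul {p : ℝ} (hp : 0 < p) (c : ℝ≥0∞) {u : ℝ → ℝ≥0∞} (hu : Measurable u) :
    NN p (fun x => c * u x) = c * NN p u := by
  unfold NN
  simp_rw [ENNReal.mul_rpow_of_nonneg _ _ hp.le]
  rw [lintegral_const_mul _ (by fun_prop), ENNReal.mul_rpow_of_nonneg _ _ (by positivity),
    ← ENNReal.rpow_mul, mul_one_div_cancel hp.ne', ENNReal.rpow_one]

/-- Hardy-Littlewood-Sobolev -/
theorem HLS (α p q : ℝ) (hα : 0 < α) (hp : 1 < p) (hq : 1 < q)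
    (hpq : 1 / p = 1 / q + α) :
    ∃ C : ℝ≥0, 0 < C ∧ ∀ f : ℝ → ℝ≥0∞, Measurable f → NN q (RI α f) ≤ C * NN p f := by
  have hq1 : 0 < q - 1 := by linarith
  have hp0 : 0 < p := by linarith
  have hr : 1 < q / (q - 1) := by rw [lt_div_iff₀ hq1]; linarith
  have hp1 : 1 / p < 1 := by rw [div_lt_one] <;> linarith
  have hα1 : α < 1 := by
    have : 0 < 1 / q := by positivity
    linarith
  obtain ⟨C, hC, H⟩ := HLS_bilin (p := q / (q - 1)) (r := p) hα hα1 hr hp (by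
    rw [hpq]; field_simp; ring)
  refine ⟨C, hC, fun f hf => ?_⟩
  have unit : ∀ f : ℝ → ℝ≥0∞, Measurable f → ∫⁻ x, f x ^ p ≤ 1 → NN q (RI α f) ≤ C :=
    fun f hf hfi => dual_aux hq (RI_meas α hf) C (fun h hh hhi => H h f hh hf hhi hfi)
  rcases eq_or_ne (NN p f) 0 with h0 | h0
  · have h1 : ∫⁻ x, f x ^ p = 0 := by
      unfold NN at h0
      rcases ENNReal.rpow_eq_zero_iff.1 h0 with h | h
      · exact h.1
      · exact absurd h.2 (by simp [hp0.le])
    have h2 : f =ᵐ[volume] 0 := by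
      rw [lintegral_eq_zero_iff (by fun_prop)] at h1
      filter_upwards [h1] with x hx
      rcases ENNReal.rpow_eq_zero_iff.1 hx with h | h
      · exact h.1
      · exact absurd h.2 (by linarith)
    have h3 : RI α f = 0 := by
      ext x
      unfold RI
      rw [lintegral_congr_ae (g := fun _ => 0)]
      · simp
      · filter_upwards [h2] with y hy
        simp [hy]
    have : NN q (RI α f) = 0 := by
      have hq0 : 0 < q := by linarith
      simp [h3, NN, hq0]
    rw [this]; exact bot_le
  rcases eq_or_ne (NN p f) ⊤ with ht | ht
  · rw [ht, ENNReal.mul_top (by simpa using hC.ne')]; exact le_top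
  · set c := (NN p f)⁻¹ with hc
    have h1 := unit (fun x => c * f x) (by fun_prop) (by
      have h2 : NN p (fun x => c * f x) = 1 := by
        rw [NN_const_mul hp0 _ hf, hc, ENNReal.inv_mul_cancel h0 ht]
      unfold NN at h2
      have h3 := congrArg (fun t => t ^ p) h2
      simp only [ENNReal.one_rpow] at h3
      rw [← ENNReal.rpow_mul, one_div_mul_cancel hp0.ne', ENNReal.rpow_one] at h3
      exact h3.le)
    have h2 : RI α (fun x => c * f x) = fun x => c * RI α f x := by
      ext x; exact RI_const_mul α c hf x
    rw [h2, NN_const_mul (by linarith) _ (RI_meas α hf), hc, mul_comm, ← div_eq_mul_inv,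
      ENNReal.div_le_iff h0 ht] at h1
    exact h1

lemma NN_mul (p q r : ℝ) (hp : 0 < p) (hpq : p < q) (h : 1 / p = 1 / q + 1 / r)
    {u v : ℝ → ℝ≥0∞} (hu : Measurable u) (hv : Measurable v) :
    NN p (fun x => u x * v x) ≤ NN q u * NN r v :=
  ENNReal.lintegral_Lp_mul_le_Lq_mul_Lr hp hpq h volume hu.aemeasurable hv.aemeasurable

lemma NN_add (p : ℝ) (hp : 1 ≤ p)
    {u v : ℝ → ℝ≥0∞} (hu : Measurable u) (hv : Measurable v) :
    NN p (fun x => u x + v x) ≤ NN p u + NN p v :=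
  ENNReal.lintegral_Lp_add_le hu.aemeasurable hv.aemeasurable hp

lemma NN_mono_ae (p : ℝ) (hp : 0 < p) {u v : ℝ → ℝ≥0∞} (h : ∀ᵐ x, u x ≤ v x) :
    NN p u ≤ NN p v := by
  unfold NN
  refine ENNReal.rpow_le_rpow (lintegral_mono_ae ?_) (by positivity)
  filter_upwards [h] with x hx
  exact ENNReal.rpow_le_rpow hx hp.le

/-- The majorant of the commutator kernel. -/
noncomputable def KK (a b c : ℝ → ℝ≥0∞) (x : ℝ) : ℝ≥0∞ :=
  (RI (3/8) c x * (RI (3/16) b x * RI (1/16) a x)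
    + RI (3/8) c x * RI (1/16) (fun y => RI (3/16) b y * a y) x)
  + (RI (3/16) c x * RI (1/16) (fun y => RI (3/8) b y * a y) x
    + RI (1/16) (fun y => RI (3/8) b y * (RI (3/16) c y * a y)) x)

lemma KK_meas {a b c : ℝ → ℝ≥0∞} (ha : Measurable a) (hb : Measurable b) (hc : Measurable c) :
    Measurable (KK a b c) := by
  have m1 := RI_meas (3/8) hb
  have m2 := RI_meas (3/16) hb
  have m3 := RI_meas (3/8) hc
  have m4 := RI_meas (3/16) hc
  have m5 := RI_meas (1/16) ha
  have m6 := RI_meas (1/16) (m2.mul ha)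
  have m7 := RI_meas (1/16) (m1.mul ha)
  have m8 := RI_meas (1/16) (m1.mul (m4.mul ha))
  exact ((m3.mul (m2.mul m5)).add (m3.mul m6)).add ((m4.mul m7).add m8)

lemma main_pos : ∃ C : ℝ≥0, ∀ a b c : ℝ → ℝ≥0∞, Measurable a → Measurable b → Measurable c →
    NN (4/3) (fun x => RI (3/8) b x * (RI (3/8) c x * a x)) ≤ C * (NN 2 a * NN 2 b * NN 2 c) ∧
    NN (4/3) (RI (1/8) (KK a b c)) ≤ C * (NN 2 a * NN 2 b * NN 2 c) := by
  obtain ⟨C1, -, H1⟩ := HLS (3/8) 2 8 (by norm_num) (by norm_num) (by norm_num) (by norm_num)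
  obtain ⟨C2, -, H2⟩ := HLS (3/16) 2 (16/5) (by norm_num) (by norm_num) (by norm_num) (by norm_num)
  obtain ⟨C3, -, H3⟩ := HLS (1/16) 2 (16/7) (by norm_num) (by norm_num) (by norm_num) (by norm_num)
  obtain ⟨C4, -, H4⟩ := HLS (1/16) (16/13) (4/3) (by norm_num) (by norm_num) (by norm_num)
    (by norm_num)
  obtain ⟨C5, -, H5⟩ := HLS (1/16) (8/5) (16/9) (by norm_num) (by norm_num) (by norm_num)
    (by norm_num)
  obtain ⟨C6, -, H6⟩ := HLS (1/16) (16/15) (8/7) (by norm_num) (by norm_num) (by norm_num)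
    (by norm_num)
  obtain ⟨C7, -, H7⟩ := HLS (1/8) (8/7) (4/3) (by norm_num) (by norm_num) (by norm_num)
    (by norm_num)
  refine ⟨C1 * C1 + C7 * (C1 * C2 * C3 + C1 * C4 * C2 + C2 * C5 * C1 + C6 * C1 * C2), ?_⟩
  intro a b c ha hb hc
  have m1 := RI_meas (3/8) hb
  have m2 := RI_meas (3/16) hb
  have m3 := RI_meas (3/8) hc
  have m4 := RI_meas (3/16) hc
  have m5 := RI_meas (1/16) ha
  have m6' : Measurable (fun y => RI (3/16) b y * a y) := m2.mul ha
  have m7' : Measurable (fun y => RI (3/8) b y * a y) := m1.mul ha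
  have m9' : Measurable (fun y => RI (3/8) c y * a y) := m3.mul ha
  have m8'' : Measurable (fun y => RI (3/16) c y * a y) := m4.mul ha
  have m8' : Measurable (fun y => RI (3/8) b y * (RI (3/16) c y * a y)) := m1.mul m8''
  have m6 := RI_meas (1/16) m6'
  have m7 := RI_meas (1/16) m7'
  have m8 := RI_meas (1/16) m8'
  have p1 : NN (4/3) (fun x => RI (3/8) b x * (RI (3/8) c x * a x))
      ≤ (C1 * C1) * (NN 2 a * NN 2 b * NN 2 c) := by
    calc _ ≤ NN 8 (RI (3/8) b) * NN (8/5) (fun x => RI (3/8) c x * a x) :=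
          NN_mul _ _ _ (by norm_num) (by norm_num) (by norm_num) m1 m9'
      _ ≤ NN 8 (RI (3/8) b) * (NN 8 (RI (3/8) c) * NN 2 a) := by
          gcongr
          exact NN_mul _ _ _ (by norm_num) (by norm_num) (by norm_num) m3 ha
      _ ≤ (C1 * NN 2 b) * ((C1 * NN 2 c) * NN 2 a) := by
          gcongr
          · exact H1 b hb
          · exact H1 c hc
      _ = _ := by ring
  have t1 : NN (8/7) (fun x => RI (3/8) c x * (RI (3/16) b x * RI (1/16) a x))
      ≤ (C1 * C2 * C3) * (NN 2 a * NN 2 b * NN 2 c) := by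
    calc _ ≤ NN 8 (RI (3/8) c) * NN (4/3) (fun x => RI (3/16) b x * RI (1/16) a x) :=
          NN_mul _ _ _ (by norm_num) (by norm_num) (by norm_num) m3 (m2.mul m5)
      _ ≤ NN 8 (RI (3/8) c) * (NN (16/5) (RI (3/16) b) * NN (16/7) (RI (1/16) a)) := by
          gcongr
          exact NN_mul _ _ _ (by norm_num) (by norm_num) (by norm_num) m2 m5
      _ ≤ (C1 * NN 2 c) * ((C2 * NN 2 b) * (C3 * NN 2 a)) := by
          gcongr
          · exact H1 c hc
          · exact H2 b hb
          · exact H3 a ha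
      _ = _ := by ring
  have t2 : NN (8/7) (fun x => RI (3/8) c x * RI (1/16) (fun y => RI (3/16) b y * a y) x)
      ≤ (C1 * C4 * C2) * (NN 2 a * NN 2 b * NN 2 c) := by
    calc _ ≤ NN 8 (RI (3/8) c) * NN (4/3) (RI (1/16) (fun y => RI (3/16) b y * a y)) :=
          NN_mul _ _ _ (by norm_num) (by norm_num) (by norm_num) m3 m6
      _ ≤ (C1 * NN 2 c) * (C4 * NN (16/13) (fun y => RI (3/16) b y * a y)) := by
          gcongr
          · exact H1 c hc
          · exact H4 _ m6'
      _ ≤ (C1 * NN 2 c) * (C4 * (NN (16/5) (RI (3/16) b) * NN 2 a)) := by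
          gcongr
          exact NN_mul _ _ _ (by norm_num) (by norm_num) (by norm_num) m2 ha
      _ ≤ (C1 * NN 2 c) * (C4 * ((C2 * NN 2 b) * NN 2 a)) := by
          gcongr
          exact H2 b hb
      _ = _ := by ring
  have t3 : NN (8/7) (fun x => RI (3/16) c x * RI (1/16) (fun y => RI (3/8) b y * a y) x)
      ≤ (C2 * C5 * C1) * (NN 2 a * NN 2 b * NN 2 c) := by
    calc _ ≤ NN (16/5) (RI (3/16) c) * NN (16/9) (RI (1/16) (fun y => RI (3/8) b y * a y)) :=
          NN_mul _ _ _ (by norm_num) (by norm_num) (by norm_num) m4 m7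
      _ ≤ (C2 * NN 2 c) * (C5 * NN (8/5) (fun y => RI (3/8) b y * a y)) := by
          gcongr
          · exact H2 c hc
          · exact H5 _ m7'
      _ ≤ (C2 * NN 2 c) * (C5 * (NN 8 (RI (3/8) b) * NN 2 a)) := by
          gcongr
          exact NN_mul _ _ _ (by norm_num) (by norm_num) (by norm_num) m1 ha
      _ ≤ (C2 * NN 2 c) * (C5 * ((C1 * NN 2 b) * NN 2 a)) := by
          gcongr
          exact H1 b hb
      _ = _ := by ring
  have t4 : NN (8/7) (RI (1/16) (fun y => RI (3/8) b y * (RI (3/16) c y * a y)))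
      ≤ (C6 * C1 * C2) * (NN 2 a * NN 2 b * NN 2 c) := by
    calc _ ≤ C6 * NN (16/15) (fun y => RI (3/8) b y * (RI (3/16) c y * a y)) := H6 _ m8'
      _ ≤ C6 * (NN 8 (RI (3/8) b) * NN (16/13) (fun y => RI (3/16) c y * a y)) := by
          gcongr
          exact NN_mul _ _ _ (by norm_num) (by norm_num) (by norm_num) m1 m8''
      _ ≤ C6 * (NN 8 (RI (3/8) b) * (NN (16/5) (RI (3/16) c) * NN 2 a)) := by
          gcongr
          exact NN_mul _ _ _ (by norm_num) (by norm_num) (by norm_num) m4 ha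
      _ ≤ C6 * ((C1 * NN 2 b) * ((C2 * NN 2 c) * NN 2 a)) := by
          gcongr
          · exact H1 b hb
          · exact H2 c hc
      _ = _ := by ring
  have p2 : NN (4/3) (RI (1/8) (KK a b c)) ≤
      (C7 * (C1 * C2 * C3 + C1 * C4 * C2 + C2 * C5 * C1 + C6 * C1 * C2))
        * (NN 2 a * NN 2 b * NN 2 c) := by
    calc _ ≤ C7 * NN (8/7) (KK a b c) := H7 _ (KK_meas ha hb hc)
      _ ≤ C7 * ((C1 * C2 * C3) * (NN 2 a * NN 2 b * NN 2 c)
          + (C1 * C4 * C2) * (NN 2 a * NN 2 b * NN 2 c)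
          + ((C2 * C5 * C1) * (NN 2 a * NN 2 b * NN 2 c)
          + (C6 * C1 * C2) * (NN 2 a * NN 2 b * NN 2 c))) := by
        gcongr
        refine (NN_add _ (by norm_num) ((m3.mul (m2.mul m5)).add (m3.mul m6))
          ((m4.mul m7).add m8)).trans (add_le_add ?_ ?_)
        · exact (NN_add _ (by norm_num) (m3.mul (m2.mul m5)) (m3.mul m6)).trans (add_le_add t1 t2)
        · exact (NN_add _ (by norm_num) (m4.mul m7) m8).trans (add_le_add t3 t4)
      _ = _ := by ring
  push_cast
  constructor
  · refine p1.trans ?_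
    rw [add_mul]; exact le_self_add
  · refine p2.trans ?_
    rw [add_mul _ _ (NN 2 a * _ * _)]; exact le_add_self

lemma pow_diff_aux {κ σ a b : ℝ} (hκ : 0 < κ) (hκ1 : κ ≤ 1) (hσ : 0 < σ) (hσ1 : σ ≤ 1)
    (ha : 0 < a) (hab : a ≤ b) : |a ^ (-κ) - b ^ (-κ)| ≤ (b - a) ^ σ * a ^ (-κ - σ) := by
  have hb : 0 < b := lt_of_lt_of_le ha hab
  have h1 : b ^ (-κ) ≤ a ^ (-κ) := Real.rpow_le_rpow_of_nonpos ha hab (by linarith)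
  rw [abs_of_nonneg (by linarith)]
  have h2 : a / b ≤ (a / b) ^ κ := by
    have := Real.rpow_le_rpow_of_exponent_ge (x := a / b) (by positivity)
      ((div_le_one hb).2 hab) hκ1
    simpa using this
  have h3 : b ^ (-κ) = a ^ (-κ) * (a / b) ^ κ := by
    rw [Real.div_rpow ha.le hb.le, Real.rpow_neg ha.le, Real.rpow_neg hb.le]
    have : 0 < a ^ κ := by positivity
    field_simp
  have h0 : 0 ≤ (b - a) / b := div_nonneg (by linarith) hb.le
  have h4 : (b - a) / b ≤ ((b - a) / b) ^ σ := by
    have := Real.rpow_le_rpow_of_exponent_ge' h0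
      ((div_le_one hb).2 (by linarith)) hσ.le hσ1
    simpa using this
  have h5 : ((b - a) / b) ^ σ ≤ ((b - a) / a) ^ σ := by
    apply Real.rpow_le_rpow h0 _ hσ.le
    exact div_le_div_of_nonneg_left (by linarith) ha hab
  have hap : 0 < a ^ (-κ) := by positivity
  calc a ^ (-κ) - b ^ (-κ) = a ^ (-κ) * (1 - (a / b) ^ κ) := by rw [h3]; ring
    _ ≤ a ^ (-κ) * ((b - a) / b) := by
        apply mul_le_mul_of_nonneg_left _ hap.le
        have : (b - a) / b = 1 - a / b := by field_simp
        linarith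
    _ ≤ a ^ (-κ) * ((b - a) / a) ^ σ := by
        apply mul_le_mul_of_nonneg_left _ hap.le
        linarith
    _ = _ := by
        rw [Real.div_rpow (by linarith) ha.le, sub_eq_add_neg (-κ), Real.rpow_add ha,
          Real.rpow_neg ha.le σ]
        ring

lemma ker_diff {β σ : ℝ} (hβ0 : 0 ≤ β) (hβ : β < 1) (hσ : 0 < σ) (hσ1 : σ ≤ 1) {x y z : ℝ}
    (hx : x ≠ z) (hy : y ≠ z) :
    |(|x - z| ^ (β - 1) - |y - z| ^ (β - 1))| ≤
      |x - y| ^ σ * (|x - z| ^ (β - σ - 1) + |y - z| ^ (β - σ - 1)) := by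
  have ha : 0 < |x - z| := abs_pos.2 (sub_ne_zero.2 hx)
  have hb : 0 < |y - z| := abs_pos.2 (sub_ne_zero.2 hy)
  have hd : |(|x - z| - |y - z|)| ≤ |x - y| := by
    have := abs_abs_sub_abs_le (x - z) (y - z)
    simpa using this
  have e1 : β - 1 = -(1 - β) := by ring
  have e2 : β - σ - 1 = -(1 - β) - σ := by ring
  rw [e1, e2]
  have q1 : 0 ≤ |x - z| ^ (-(1 - β) - σ) := by positivity
  have q2 : 0 ≤ |y - z| ^ (-(1 - β) - σ) := by positivity
  have q3 : 0 ≤ |x - y| ^ σ := by positivity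
  rcases le_total |x - z| |y - z| with h | h
  · refine (pow_diff_aux (κ := 1 - β) (by linarith) (by linarith) hσ hσ1 ha h).trans ?_
    have : (|y - z| - |x - z|) ^ σ ≤ |x - y| ^ σ := by
      apply Real.rpow_le_rpow (by linarith) _ hσ.le
      rw [abs_sub_comm] at hd
      exact (le_abs_self _).trans hd
    nlinarith [mul_le_mul_of_nonneg_right this q1, mul_nonneg q3 q2]
  · rw [abs_sub_comm]
    refine (pow_diff_aux (κ := 1 - β) (by linarith) (by linarith) hσ hσ1 hb h).trans ?_
    have : (|x - z| - |y - z|) ^ σ ≤ |x - y| ^ σ := by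
      apply Real.rpow_le_rpow (by linarith) _ hσ.le
      exact (le_abs_self _).trans hd
    nlinarith [mul_le_mul_of_nonneg_right this q2, mul_nonneg q3 q1]

lemma RI_diff {β σ : ℝ} (hβ0 : 0 ≤ β) (hβ : β < 1) (hσ : 0 < σ) (hσ1 : σ ≤ 1) (x y : ℝ)
    {b : ℝ → ℝ≥0∞} (hb : Measurable b) :
    ∫⁻ z, ENNReal.ofReal |(|x - z| ^ (β - 1) - |y - z| ^ (β - 1))| * b z ≤
      ENNReal.ofReal (|x - y| ^ σ) * (RI (β - σ) b x + RI (β - σ) b y) := by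
  unfold RI
  rw [← lintegral_add_left (by fun_prop), ← lintegral_const_mul _ (by fun_prop)]
  refine lintegral_mono_ae ?_
  have hx : ∀ᵐ z : ℝ, z ≠ x := by simp [ae_iff, measure_singleton]
  have hy : ∀ᵐ z : ℝ, z ≠ y := by simp [ae_iff, measure_singleton]
  filter_upwards [hx, hy] with z hzx hzy
  rw [← add_mul, ← mul_assoc, ← ENNReal.ofReal_add (by positivity) (by positivity),
    ← ENNReal.ofReal_mul (by positivity)]
  gcongr
  exact ker_diff hβ0 hβ hσ hσ1 hzx.symm hzy.symm

/-- (unnormalized) inverse Fourier integral -/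
noncomputable def EE (m : ℝ → ℂ) (x : ℝ) : ℂ := ∫ ξ, m ξ * Complex.exp (Complex.I * x * ξ)

lemma norm_exp_I (x ξ : ℝ) : ‖Complex.exp (Complex.I * x * ξ)‖ = 1 := by
  rw [show Complex.I * x * ξ = ((x * ξ : ℝ) : ℂ) * Complex.I by push_cast; ring]
  exact Complex.norm_exp_ofReal_mul_I _

lemma EE_integrable {m : ℝ → ℂ} (hm : Integrable m) (x : ℝ) :
    Integrable (fun ξ : ℝ => m ξ * Complex.exp (Complex.I * x * ξ)) := by
  refine hm.mul_bdd (c := 1) (by fun_prop) (Filter.Eventually.of_forall fun ξ => ?_)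
  rw [norm_exp_I]

lemma EE_continuous {m : ℝ → ℂ} (hm : Integrable m) : Continuous (EE m) := by
  refine continuous_of_dominated (bound := fun ξ => ‖m ξ‖) ?_ ?_ hm.norm ?_
  · exact fun x => (EE_integrable hm x).aestronglyMeasurable
  · intro x
    refine Filter.Eventually.of_forall fun ξ => ?_
    rw [norm_mul, norm_exp_I, mul_one]
  · refine Filter.Eventually.of_forall fun ξ => ?_
    fun_prop

lemma EE_congr {m n : ℝ → ℂ} (h : m =ᵐ[volume] n) : EE m = EE n := by
  ext x
  refine integral_congr_ae ?_
  filter_upwards [h] with ξ hξ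
  rw [hξ]

lemma EE_sub {m n : ℝ → ℂ} (hm : Integrable m) (hn : Integrable n) (x : ℝ) :
    EE (fun ξ => m ξ - n ξ) x = EE m x - EE n x := by
  unfold EE
  rw [← integral_sub (EE_integrable hm x) (EE_integrable hn x)]
  congr 1; ext ξ; ring

lemma fub_aux {k : ℝ × ℝ → ℝ} (hk : Measurable k) (hk0 : ∀ l ∈ Set.Ioi (0:ℝ), ∀ y, 0 ≤ k (l, y))
    {f : ℝ → ℂ} (hf : AEStronglyMeasurable f) {κ : ℝ → ℝ} (hκ : ∀ y, 0 ≤ κ y)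
    (h : ∀ᵐ y, ∫⁻ l in Set.Ioi (0:ℝ), ENNReal.ofReal (k (l, y)) = ENNReal.ofReal (κ y))
    (hfin : ∫⁻ y, ENNReal.ofReal (κ y) * ‖f y‖ₑ < ⊤) :
    ∫ l in Set.Ioi (0:ℝ), ∫ y, (k (l, y) : ℂ) * f y = ∫ y, (κ y : ℂ) * f y := by
  have hm : AEStronglyMeasurable (fun z : ℝ × ℝ => (k z : ℂ) * f z.2)
      ((volume.restrict (Set.Ioi 0)).prod volume) :=
    (by fun_prop : Measurable fun z : ℝ × ℝ => (k z : ℂ)).aestronglyMeasurable.mul hf.comp_snd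
  have hI : Integrable (fun z : ℝ × ℝ => (k z : ℂ) * f z.2)
      ((volume.restrict (Set.Ioi 0)).prod volume) := by
    refine ⟨hm, ?_⟩
    unfold HasFiniteIntegral
    rw [lintegral_prod_symm _ hm.enorm]
    refine lt_of_le_of_lt (lintegral_mono_ae ?_) hfin
    filter_upwards [h] with y hy
    rw [← hy, ← lintegral_mul_const _ (by fun_prop)]
    refine setLIntegral_mono' measurableSet_Ioi fun l hl => ?_
    rw [enorm_mul]
    gcongr
    rw [← ofReal_norm, Complex.norm_real, Real.norm_of_nonneg (hk0 l hl y)]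
  have := integral_integral_swap (f := fun l y => (k (l, y) : ℂ) * f y) hI
  rw [this]
  refine integral_congr_ae ?_
  filter_upwards [h] with y hy
  rw [integral_mul_const, integral_complex_ofReal]
  congr 2
  rw [integral_eq_lintegral_of_nonneg_ae, hy, ENNReal.toReal_ofReal (hκ y)]
  · filter_upwards [ae_restrict_mem measurableSet_Ioi] with l hl
    exact hk0 l hl y
  · exact Measurable.aestronglyMeasurable (by fun_prop)

lemma lint_gamma {a r : ℝ} (ha : 0 < a) (hr : 0 < r) :
    ∫⁻ t in Set.Ioi (0:ℝ), ENNReal.ofReal (t ^ (a - 1) * rexp (-(r * t)))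
      = ENNReal.ofReal ((1 / r) ^ a * Real.Gamma a) := by
  have h := Real.integral_rpow_mul_exp_neg_mul_Ioi ha hr
  have hpos : 0 < (1 / r) ^ a * Real.Gamma a := mul_pos (by positivity) (Real.Gamma_pos_of_pos ha)
  rw [← h, ofReal_integral_eq_lintegral_ofReal]
  · by_contra hc
    rw [integral_undef hc] at h
    linarith
  · filter_upwards [ae_restrict_mem measurableSet_Ioi] with t ht
    have : 0 < t := ht
    positivity

lemma lint_gamma_inv {a r : ℝ} (ha : 0 < a) (hr : 0 < r) :
    ∫⁻ t in Set.Ioi (0:ℝ), ENNReal.ofReal (t ^ (-a - 1) * rexp (-(r / t)))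
      = ENNReal.ofReal ((1 / r) ^ a * Real.Gamma a) := by
  have h := Real.integral_rpow_mul_exp_neg_mul_Ioi ha hr
  rw [← integral_comp_rpow_Ioi _ (show (-1:ℝ) ≠ 0 by norm_num)] at h
  have hpos : 0 < (1 / r) ^ a * Real.Gamma a := mul_pos (by positivity) (Real.Gamma_pos_of_pos ha)
  have h' : ∫ t in Set.Ioi (0:ℝ), t ^ (-a - 1) * rexp (-(r / t))
      = (1 / r) ^ a * Real.Gamma a := by
    rw [← h]
    refine setIntegral_congr_fun measurableSet_Ioi fun t ht => ?_
    have ht : 0 < t := ht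
    simp only [smul_eq_mul, abs_neg, abs_one, one_mul]
    rw [← Real.rpow_mul ht.le, ← mul_assoc, ← Real.rpow_add ht, Real.rpow_neg_one, div_eq_mul_inv]
    ring_nf
  rw [← h', ofReal_integral_eq_lintegral_ofReal]
  · by_contra hc
    rw [integral_undef hc] at h'
    linarith
  · filter_upwards [ae_restrict_mem measurableSet_Ioi] with t ht
    have : 0 < t := ht
    positivity

lemma gauss_ident {m : ℝ → ℂ} (hm : Integrable m) {l : ℝ} (hl : 0 < l) (x : ℝ) :
    ∫ y, (rexp (-(l * (x - y) ^ 2)) : ℂ) * EE m y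
      = ∫ ξ, ((π / l) ^ (1 / 2 : ℝ) * rexp (-(ξ ^ 2 / (4 * l))) : ℝ)
          * (m ξ * Complex.exp (Complex.I * x * ξ)) := by
  have hg : Integrable (fun y : ℝ => (rexp (-(l * (x - y) ^ 2)) : ℂ)) := by
    have := (integrable_exp_neg_mul_sq hl).comp_sub_left x
    simp only [neg_mul] at this
    exact this.ofReal
  have hI : Integrable (fun z : ℝ × ℝ => (rexp (-(l * (x - z.1) ^ 2)) : ℂ) *
      (m z.2 * Complex.exp (Complex.I * z.1 * z.2))) (volume.prod volume) := by
    have h1 := hg.mul_prod hm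
    have h2 := h1.mul_bdd (c := 1) (g := fun z : ℝ × ℝ => Complex.exp (Complex.I * z.1 * z.2))
      (by fun_prop) (Filter.Eventually.of_forall fun z => by rw [norm_exp_I])
    refine h2.congr (Filter.Eventually.of_forall fun z => ?_)
    simp only []; ring
  unfold EE
  simp_rw [← integral_const_mul]
  rw [integral_integral_swap (f := fun y ξ : ℝ => (rexp (-(l * (x - y) ^ 2)) : ℂ) *
      (m ξ * Complex.exp (Complex.I * y * ξ))) hI]
  congr 1; ext ξ
  have e1 : ∀ y : ℝ, (rexp (-(l * (x - y) ^ 2)) : ℂ) * (m ξ * Complex.exp (Complex.I * y * ξ))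
      = (m ξ * Complex.exp (Complex.I * x * ξ)) *
        (fun t : ℝ => Complex.exp (Complex.I * (-ξ : ℂ) * t) * Complex.exp (-(l:ℂ) * t ^ 2))
          (x - y) := by
    intro y
    simp only []
    push_cast
    have : Complex.exp (Complex.I * y * ξ) = Complex.exp (Complex.I * x * ξ) *
        Complex.exp (Complex.I * (-ξ : ℂ) * (x - y)) := by
      rw [← Complex.exp_add]; congr 1; ring
    rw [this]; ring_nf
  simp_rw [e1]
  rw [integral_const_mul, integral_sub_left_eq_self
    (fun t : ℝ => Complex.exp (Complex.I * (-ξ : ℂ) * t) * Complex.exp (-(l:ℂ) * t ^ 2)),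
    fourierIntegral_gaussian (by simpa using hl)]
  rw [mul_comm]
  congr 1
  push_cast
  rw [Complex.ofReal_cpow (by positivity)]
  push_cast
  congr 2
  ring

theorem riesz {β : ℝ} (hβ : 0 < β) (hβ1 : β < 1) : ∃ c : ℝ, 0 < c ∧
    ∀ m : ℝ → ℂ, Integrable m → Integrable (fun ξ => ((|ξ| ^ (-β) : ℝ) : ℂ) * m ξ) →
    ∀ x, RI β (fun y => ‖EE m y‖ₑ) x < ⊤ →
      EE (fun ξ => ((|ξ| ^ (-β) : ℝ) : ℂ) * m ξ) x
        = c * ∫ y, ((|x - y| ^ (β - 1) : ℝ) : ℂ) * EE m y := by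
  set A : ℝ := Real.Gamma ((1 - β) / 2) with hA
  set B : ℝ := π ^ (1 / 2 : ℝ) * (4 ^ (β / 2) * Real.Gamma (β / 2)) with hB
  have hAp : 0 < A := Real.Gamma_pos_of_pos (by linarith)
  have hBp : 0 < B := by
    have := Real.Gamma_pos_of_pos (show 0 < β / 2 by linarith)
    positivity
  refine ⟨A / B, by positivity, fun m hm hm' x hx => ?_⟩
  have hne : ∀ a : ℝ, ∀ᵐ z : ℝ, z ≠ a := fun a => by simp [ae_iff, measure_singleton]
  -- first evaluation
  have h1 := fub_aux (k := fun z => z.1 ^ ((1 - β) / 2 - 1) * rexp (-(z.1 * (x - z.2) ^ 2)))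
    (by fun_prop) (fun l hl y => by have : 0 < l := hl; positivity)
    (f := EE m) (EE_continuous hm).aestronglyMeasurable
    (κ := fun y => A * |x - y| ^ (β - 1)) (fun y => by positivity)
    (by
      filter_upwards [hne x] with y hy
      have hp : 0 < |x - y| := abs_pos.2 (sub_ne_zero.2 hy.symm)
      have := lint_gamma (a := (1 - β) / 2) (r := (x - y) ^ 2) (by linarith)
        (by rw [← sq_abs]; positivity)
      convert this using 2
      · ext l; ring_nf
      · rw [mul_comm A, ← sq_abs (x - y), one_div, Real.inv_rpow (by positivity),
          ← Real.rpow_natCast, ← Real.rpow_mul hp.le, ← Real.rpow_neg hp.le]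
        congr 2; push_cast; ring)
    (by
      have : ∀ y, ENNReal.ofReal (A * |x - y| ^ (β - 1)) * ‖EE m y‖ₑ
          = ENNReal.ofReal A * (ENNReal.ofReal (|x - y| ^ (β - 1)) * ‖EE m y‖ₑ) := by
        intro y; rw [ENNReal.ofReal_mul hAp.le, mul_assoc]
      simp_rw [this]
      have hcm := (EE_continuous hm).measurable
      rw [lintegral_const_mul _ (by fun_prop)]
      exact ENNReal.mul_lt_top (by simp) hx)
  have h2 := fub_aux (k := fun z => z.1 ^ ((1 - β) / 2 - 1) *
      ((π / z.1) ^ (1 / 2 : ℝ) * rexp (-(z.2 ^ 2 / (4 * z.1)))))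
    (by fun_prop) (fun l hl y => by have : 0 < l := hl; positivity)
    (f := fun ξ => m ξ * Complex.exp (Complex.I * x * ξ)) (EE_integrable hm x).aestronglyMeasurable
    (κ := fun ξ => B * |ξ| ^ (-β)) (fun y => by positivity)
    (by
      filter_upwards [hne 0] with ξ hξ
      have hp : 0 < |ξ| := abs_pos.2 hξ
      have := lint_gamma_inv (a := β / 2) (r := ξ ^ 2 / 4) (by linarith)
        (by rw [← sq_abs]; positivity)
      have e : ∀ l ∈ Set.Ioi (0:ℝ), ENNReal.ofReal (l ^ ((1 - β) / 2 - 1) *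
          ((π / l) ^ (1 / 2 : ℝ) * rexp (-(ξ ^ 2 / (4 * l)))))
          = ENNReal.ofReal (π ^ (1 / 2 : ℝ)) * ENNReal.ofReal
            (l ^ (-(β / 2) - 1) * rexp (-(ξ ^ 2 / 4 / l))) := by
        intro l hl
        have hl : 0 < l := hl
        rw [← ENNReal.ofReal_mul (by positivity)]
        congr 1
        rw [Real.div_rpow pi_pos.le hl.le, div_div,
          show -(β / 2) - 1 = ((1 - β) / 2 - 1) - 1 / 2 by ring, Real.rpow_sub hl _ (1 / 2)]
        ring
      rw [setLIntegral_congr_fun measurableSet_Ioi e, lintegral_const_mul _ (by fun_prop), this,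
        ← ENNReal.ofReal_mul (by positivity)]
      congr 1
      rw [hB, ← sq_abs ξ, one_div_div, Real.div_rpow (by positivity) (by positivity),
        ← Real.rpow_natCast |ξ|, ← Real.rpow_mul hp.le, Real.rpow_neg hp.le,
        show ((2:ℕ):ℝ) * (β / 2) = β by push_cast; ring]
      field_simp)
    (by
      have h3 := (EE_integrable hm' x).2
      unfold HasFiniteIntegral at h3
      have h4 := ENNReal.mul_lt_top (a := ENNReal.ofReal B) (by simp) h3
      rw [← lintegral_const_mul' _ _ (by simp)] at h4
      convert h4 using 3 with ξ
      have e6 : ‖((|ξ| ^ (-β) : ℝ) : ℂ) * m ξ * Complex.exp (Complex.I * x * ξ)‖ₑ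
          = ENNReal.ofReal (|ξ| ^ (-β)) * ‖m ξ * Complex.exp (Complex.I * x * ξ)‖ₑ := by
        rw [mul_assoc, enorm_mul]
        congr 1
        rw [← ofReal_norm, Complex.norm_real, Real.norm_of_nonneg (by positivity)]
      rw [e6, ENNReal.ofReal_mul hBp.le, mul_assoc])
  have h3 : ∫ l in Set.Ioi (0:ℝ), ∫ y, ((l ^ ((1 - β) / 2 - 1) * rexp (-(l * (x - y) ^ 2)) : ℝ) : ℂ)
        * EE m y
      = ∫ l in Set.Ioi (0:ℝ), ∫ ξ, ((l ^ ((1 - β) / 2 - 1) *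
      ((π / l) ^ (1 / 2 : ℝ) * rexp (-(ξ ^ 2 / (4 * l)))) : ℝ) : ℂ) *
        (m ξ * Complex.exp (Complex.I * x * ξ)) := by
    refine setIntegral_congr_fun measurableSet_Ioi fun l hl => ?_
    have := congrArg (fun t => ((l ^ ((1 - β) / 2 - 1) : ℝ) : ℂ) * t) (gauss_ident hm hl x)
    simp only [← integral_const_mul] at this
    refine Eq.trans (integral_congr_ae (Filter.Eventually.of_forall fun y => ?_))
      (this.trans (integral_congr_ae (Filter.Eventually.of_forall fun y => ?_)))
    · dsimp only; push_cast; ring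
    · dsimp only; push_cast; ring
  dsimp only at h1 h2
  rw [h3, h2] at h1
  have h4 : ∫ ξ, ((B * |ξ| ^ (-β) : ℝ) : ℂ) * (m ξ * Complex.exp (Complex.I * x * ξ))
      = B * EE (fun ξ => ((|ξ| ^ (-β) : ℝ) : ℂ) * m ξ) x := by
    unfold EE
    rw [← integral_const_mul]
    congr 1; ext ξ; push_cast; ring
  have h5 : ∫ y, ((A * |x - y| ^ (β - 1) : ℝ) : ℂ) * EE m y
      = A * ∫ y, ((|x - y| ^ (β - 1) : ℝ) : ℂ) * EE m y := by
    rw [← integral_const_mul]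
    congr 1; ext ξ; push_cast; ring
  rw [h4, h5] at h1
  have hBc : (B:ℂ) ≠ 0 := by exact_mod_cast hBp.ne'
  push_cast
  rw [div_mul_eq_mul_div, eq_div_iff hBc, mul_comm, h1]

lemma EE_enorm_meas {m : ℝ → ℂ} (hm : Integrable m) : Measurable (fun y => ‖EE m y‖ₑ) :=
  (EE_continuous hm).measurable.enorm

theorem riesz_bounds {β σ : ℝ} (hβ : 0 < β) (hβ1 : β < 1) (hσ : 0 < σ) (hσ1 : σ ≤ 1) :
    ∃ C : ℝ≥0, ∀ m : ℝ → ℂ, Integrable m →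
      Integrable (fun ξ => ((|ξ| ^ (-β) : ℝ) : ℂ) * m ξ) →
      (∀ x, ‖EE (fun ξ => ((|ξ| ^ (-β) : ℝ) : ℂ) * m ξ) x‖ₑ ≤ C * RI β (fun y => ‖EE m y‖ₑ) x) ∧
      (∀ x y, RI β (fun y => ‖EE m y‖ₑ) x < ⊤ → RI β (fun y => ‖EE m y‖ₑ) y < ⊤ →
        ‖EE (fun ξ => ((|ξ| ^ (-β) : ℝ) : ℂ) * m ξ) x
          - EE (fun ξ => ((|ξ| ^ (-β) : ℝ) : ℂ) * m ξ) y‖ₑ ≤ C * (ENNReal.ofReal (|x - y| ^ σ) *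
            (RI (β - σ) (fun y => ‖EE m y‖ₑ) x + RI (β - σ) (fun y => ‖EE m y‖ₑ) y))) := by
  obtain ⟨c, hc, H⟩ := riesz hβ hβ1
  refine ⟨c.toNNReal, fun m hm hm' => ?_⟩
  have hce : ‖(c : ℂ)‖ₑ = (c.toNNReal : ℝ≥0∞) := by
    rw [← ofReal_norm, Complex.norm_real, Real.norm_of_nonneg hc.le]
    rfl
  have hk : ∀ x y : ℝ, ‖((|x - y| ^ (β - 1) : ℝ) : ℂ) * EE m y‖ₑ
      = ENNReal.ofReal (|x - y| ^ (β - 1)) * ‖EE m y‖ₑ := by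
    intro x y
    rw [enorm_mul, ← ofReal_norm, Complex.norm_real, Real.norm_of_nonneg (by positivity)]
  have hI : ∀ x, RI β (fun y => ‖EE m y‖ₑ) x < ⊤ →
      Integrable (fun y => ((|x - y| ^ (β - 1) : ℝ) : ℂ) * EE m y) := by
    intro x hx
    have := (EE_continuous hm).measurable
    refine ⟨Measurable.aestronglyMeasurable (by fun_prop), ?_⟩
    unfold HasFiniteIntegral
    simp_rw [hk]
    exact hx
  constructor
  · intro x
    by_cases hx : RI β (fun y => ‖EE m y‖ₑ) x < ⊤
    · rw [H m hm hm' x hx, enorm_mul, hce]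
      gcongr
      refine (enorm_integral_le_lintegral_enorm _).trans ?_
      simp_rw [hk]
      exact le_rfl
    · have : RI β (fun y => ‖EE m y‖ₑ) x = ⊤ := by simpa using hx
      rw [this, ENNReal.mul_top]
      · exact le_top
      · simpa using hc
  · intro x y hx hy
    rw [H m hm hm' x hx, H m hm hm' y hy, ← mul_sub, ← integral_sub (hI x hx) (hI y hy),
      enorm_mul, hce]
    gcongr
    refine (enorm_integral_le_lintegral_enorm _).trans ?_
    refine le_trans (le_of_eq ?_) (RI_diff hβ.le hβ1 hσ hσ1 x y (EE_enorm_meas hm))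
    congr 1; ext z
    rw [← sub_mul, enorm_mul, ← Complex.ofReal_sub, ← ofReal_norm, Complex.norm_real, Real.norm_eq_abs]

/-- the kernel `(1 - e^{it}) |t|^{-1-s}` -/
noncomputable def KD (s t : ℝ) : ℂ := (1 - Complex.exp (Complex.I * t)) * ((|t| ^ (-1 - s) : ℝ) : ℂ)

lemma KD_norm_le (t : ℝ) : ‖1 - Complex.exp (Complex.I * t)‖ ≤ |t| ∧
    ‖1 - Complex.exp (Complex.I * t)‖ ≤ 2 := by
  constructor
  · rw [norm_sub_rev]
    simpa using Real.norm_exp_I_mul_ofReal_sub_one_le (x := t)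
  · refine (norm_sub_le _ _).trans ?_
    rw [mul_comm, Complex.norm_exp_ofReal_mul_I]; norm_num

lemma KD_integrable {s : ℝ} (hs : 0 < s) (hs1 : s < 1) : Integrable (KD s) := by
  have hmeas : Measurable (KD s) := by unfold KD; fun_prop
  have hn : ∀ t, ‖KD s t‖ = ‖1 - Complex.exp (Complex.I * t)‖ * |t| ^ (-1 - s) := by
    intro t
    rw [KD, norm_mul, Complex.norm_real, Real.norm_of_nonneg (by positivity)]
  have key : IntegrableOn (KD s) (Set.Ioi 0) := by
    rw [← Set.Ioc_union_Ioi_eq_Ioi zero_le_one]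
    refine IntegrableOn.union ?_ ?_
    · have : IntegrableOn (fun t : ℝ => t ^ (-s)) (Set.Ioc 0 1) :=
        (intervalIntegral.intervalIntegrable_rpow' (by linarith) : IntervalIntegrable _ _ 0 1).1
      refine Integrable.mono' this hmeas.aestronglyMeasurable ?_
      filter_upwards [ae_restrict_mem measurableSet_Ioc] with t ht
      rw [hn]
      have ht0 : 0 < t := ht.1
      calc _ ≤ |t| * |t| ^ (-1 - s) := by gcongr; exact (KD_norm_le t).1
        _ = _ := by
          rw [abs_of_pos ht0, show -s = 1 + (-1 - s) by ring, Real.rpow_add ht0, Real.rpow_one]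
    · have := (integrableOn_Ioi_rpow_of_lt (show -1 - s < -1 by linarith) one_pos).const_mul 2
      refine Integrable.mono' this hmeas.aestronglyMeasurable ?_
      filter_upwards [ae_restrict_mem measurableSet_Ioi] with t ht
      rw [hn]
      have ht0 : 0 < t := lt_trans one_pos ht
      rw [abs_of_pos ht0]
      gcongr; exact (KD_norm_le t).2
  have key2 : IntegrableOn (KD s) (Set.Iic 0) := by
    refine (integrable_norm_iff hmeas.aestronglyMeasurable).1 ?_
    have h1 : IntegrableOn (fun t => ‖KD s t‖) (Set.Ioi (-0)) := by
      rw [neg_zero]; exact Integrable.norm key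
    rw [← integrableOn_Ici_iff_integrableOn_Ioi] at h1
    have h2 := h1.comp_neg_Iic
    refine h2.congr (Filter.Eventually.of_forall fun t => ?_)
    simp only [hn, abs_neg]
    congr 1
    rw [← norm_neg (1 - _), ← mul_one ‖-(1 - _)‖, ← norm_exp_I 1 t, ← norm_mul]
    congr 1
    simp only [neg_sub, sub_mul, ← Complex.exp_add]
    push_cast
    simp
  have := key2.union key
  rwa [Set.Iic_union_Ioi, integrableOn_univ] at this

lemma KD_ne {s : ℝ} (hs : 0 < s) (hs1 : s < 1) : ∫ t, KD s t ≠ 0 := by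
  intro h
  have h2 : ∫ t, (KD s t).re = 0 := by
    have := integral_re (KD_integrable hs hs1)
    simp only [RCLike.re_to_complex] at this
    rw [this, h]; simp
  have hre : ∀ t, (KD s t).re = (1 - Real.cos t) * |t| ^ (-1 - s) := by
    intro t
    rw [KD, Complex.re_mul_ofReal, mul_comm Complex.I, Complex.sub_re, Complex.exp_ofReal_mul_I_re]
    simp
  have hint : Integrable (fun t => (KD s t).re) := (KD_integrable hs hs1).re
  have := (integral_pos_iff_support_of_nonneg (f := fun t => (KD s t).re) (fun t => by
    simp only [hre, Pi.zero_apply]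
    have := Real.cos_le_one t
    exact mul_nonneg (by linarith) (by positivity)) hint).2 (by
      have hsub : Set.Ioo (1:ℝ) 2 ⊆ Function.support (fun t => (KD s t).re) := by
        intro t ht
        simp only [Function.mem_support, hre]
        have h0 : 0 < |t| := abs_pos.2 (by linarith [ht.1])
        have : Real.cos t < 1 := by
          have := Real.cos_lt_cos_of_nonneg_of_le_pi (x := 0) (y := t) le_rfl
            (by linarith [ht.2, Real.pi_gt_three]) (by linarith [ht.1])
          simpa using this
        have h3 : 0 < (1 - Real.cos t) * |t| ^ (-1 - s) := mul_pos (by linarith) (by positivity)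
        exact h3.ne'
      refine lt_of_lt_of_le ?_ (measure_mono hsub)
      simp)
  linarith

theorem lemmaD {s : ℝ} (hs : 0 < s) (hs1 : s < 1) {m : ℝ → ℂ} (hm : Integrable m)
    (hm' : Integrable (fun ξ => ((|ξ| ^ s : ℝ) : ℂ) * m ξ)) (x : ℝ) :
    Integrable (fun y => (EE m x - EE m y) * ((|x - y| ^ (-1 - s) : ℝ) : ℂ)) ∧
    ∫ y, (EE m x - EE m y) * ((|x - y| ^ (-1 - s) : ℝ) : ℂ)
      = (∫ t, KD s t) * EE (fun ξ => ((|ξ| ^ s : ℝ) : ℂ) * m ξ) x := by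
  set Φ : ℝ × ℝ → ℂ := fun z => m z.2 * Complex.exp (Complex.I * x * z.2) *
    ((1 - Complex.exp (Complex.I * (z.1 - x) * z.2)) * ((|x - z.1| ^ (-1 - s) : ℝ) : ℂ)) with hΦ
  have hΦm : AEStronglyMeasurable Φ (volume.prod volume) := by
    refine ((hm.aestronglyMeasurable.comp_snd).mul ?_).mul ?_
    · exact Measurable.aestronglyMeasurable (by fun_prop)
    · exact Measurable.aestronglyMeasurable (by fun_prop)
  have hscale : ∀ ξ : ℝ, ξ ≠ 0 → ∀ y : ℝ,
      (1 - Complex.exp (Complex.I * (y - x) * ξ)) * ((|x - y| ^ (-1 - s) : ℝ) : ℂ)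
        = ((|ξ| ^ (1 + s) : ℝ) : ℂ) * (fun t => KD s (t * ξ)) (y - x) := by
    intro ξ hξ y
    have hp : 0 < |ξ| := abs_pos.2 hξ
    simp only [KD]
    rw [abs_mul, Real.mul_rpow (abs_nonneg _) (abs_nonneg _), abs_sub_comm y x]
    have : |ξ| ^ (1 + s) * |ξ| ^ (-1 - s) = 1 := by
      rw [← Real.rpow_add hp]; ring_nf; simp
    have h2 : ((|ξ| ^ (1 + s) : ℝ) : ℂ) * ((|ξ| ^ (-1 - s) : ℝ) : ℂ) = 1 := by exact_mod_cast this
    push_cast at h2 ⊢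
    have e : Complex.I * ((y - x) * ξ) = Complex.I * (y - x) * ξ := by ring
    rw [e]
    linear_combination (-(1 - Complex.exp (Complex.I * (y - x) * ξ)) *
      ((|x - y| ^ (-1 - s) : ℝ) : ℂ)) * h2
  have hne : ∀ᵐ z : ℝ, z ≠ 0 := by simp [ae_iff, measure_singleton]
  have hJ : ∀ ξ : ℝ, ξ ≠ 0 → Integrable (fun y : ℝ =>
      (1 - Complex.exp (Complex.I * (y - x) * ξ)) * ((|x - y| ^ (-1 - s) : ℝ) : ℂ)) := by
    intro ξ hξ
    have := (((KD_integrable hs hs1).comp_mul_right' hξ).comp_sub_right x).const_mul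
      ((|ξ| ^ (1 + s) : ℝ) : ℂ)
    refine this.congr (Filter.Eventually.of_forall fun y => ?_)
    exact (hscale ξ hξ y).symm
  have hpw : ∀ ξ : ℝ, ξ ≠ 0 → |ξ| ^ (1 + s) * |ξ|⁻¹ = |ξ| ^ s := by
    intro ξ hξ
    have hp : 0 < |ξ| := abs_pos.2 hξ
    rw [Real.rpow_add hp, Real.rpow_one]; field_simp
  have hJ1 : ∀ ξ : ℝ, ξ ≠ 0 → ∫ y : ℝ,
      (1 - Complex.exp (Complex.I * (y - x) * ξ)) * ((|x - y| ^ (-1 - s) : ℝ) : ℂ)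
        = ((|ξ| ^ s : ℝ) : ℂ) * ∫ t, KD s t := by
    intro ξ hξ
    simp_rw [hscale ξ hξ]
    rw [integral_const_mul, integral_sub_right_eq_self (fun t => KD s (t * ξ)) x,
      Measure.integral_comp_mul_right, ← hpw ξ hξ, abs_inv]
    push_cast
    rw [Complex.real_smul]; push_cast; ring
  have hJ2 : ∀ ξ : ℝ, ξ ≠ 0 → ∫ y : ℝ,
      ‖(1 - Complex.exp (Complex.I * (y - x) * ξ)) * ((|x - y| ^ (-1 - s) : ℝ) : ℂ)‖
        = |ξ| ^ s * ∫ t, ‖KD s t‖ := by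
    intro ξ hξ
    simp_rw [hscale ξ hξ, norm_mul]
    rw [integral_const_mul, integral_sub_right_eq_self (fun t => ‖KD s (t * ξ)‖) x,
      Measure.integral_comp_mul_right (fun t => ‖KD s t‖), ← hpw ξ hξ, abs_inv, Complex.norm_real,
      Real.norm_of_nonneg (by positivity), smul_eq_mul, mul_assoc]
  have hI : Integrable Φ (volume.prod volume) := by
    rw [integrable_prod_iff' hΦm]
    constructor
    · filter_upwards [hne] with ξ hξ
      exact (hJ ξ hξ).const_mul (m ξ * Complex.exp (Complex.I * x * ξ))
    · have h3 := (hm'.norm).mul_const (∫ t, ‖KD s t‖)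
      refine h3.congr ?_
      filter_upwards [hne] with ξ hξ
      simp only [hΦ]
      simp_rw [norm_mul (m ξ * _)]
      rw [integral_const_mul, hJ2 ξ hξ, norm_mul (m ξ), norm_exp_I, norm_mul, Complex.norm_real,
        Real.norm_of_nonneg (by positivity)]
      ring
  have hin : ∀ y, ∫ ξ, Φ (y, ξ) = (EE m x - EE m y) * ((|x - y| ^ (-1 - s) : ℝ) : ℂ) := by
    intro y
    unfold EE
    rw [← integral_sub (EE_integrable hm x) (EE_integrable hm y), ← integral_mul_const]
    congr 1; ext ξ
    simp only [hΦ]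
    have : Complex.exp (Complex.I * y * ξ) = Complex.exp (Complex.I * x * ξ) *
        Complex.exp (Complex.I * (y - x) * ξ) := by
      rw [← Complex.exp_add]; congr 1; ring
    rw [this]; ring
  constructor
  · refine hI.integral_prod_left.congr (Filter.Eventually.of_forall hin)
  · simp_rw [← hin]
    rw [integral_integral_swap (f := fun y ξ => Φ (y, ξ)) hI, EE, ← integral_const_mul]
    refine integral_congr_ae ?_
    filter_upwards [hne] with ξ hξ
    simp only [hΦ]
    rw [integral_const_mul, hJ1 ξ hξ]
    ring

lemma sub_rpow_le {s : ℝ} (hs : 0 < s) (hs1 : s ≤ 1) (ξ η : ℝ) :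
    |ξ| ^ s ≤ |ξ - η| ^ s + |η| ^ s := by
  have h : |ξ| ≤ |ξ - η| + |η| := by
    have := abs_add_le (ξ - η) η; simpa using this
  exact (Real.rpow_le_rpow (abs_nonneg _) h hs.le).trans
    (Real.rpow_add_le_add_rpow (abs_nonneg _) (abs_nonneg _) hs.le hs1)

lemma conv_int {w n : ℝ → ℂ} (hw : Integrable w) (hn : Integrable n) :
    Integrable (fun z : ℝ × ℝ => w (z.1 - z.2) * n z.2) (volume.prod volume) := by
  have := hn.convolution_integrand (ContinuousLinearMap.mul ℝ ℂ) hw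
  refine this.congr (Filter.Eventually.of_forall fun z => ?_)
  simp [mul_comm]

theorem conv_EE {w n : ℝ → ℂ} (hw : Integrable w) (hn : Integrable n) {s : ℝ} (hs : 0 < s)
    (hs1 : s ≤ 1) (hw' : Integrable (fun ξ => ((|ξ| ^ s : ℝ) : ℂ) * w ξ))
    (hn' : Integrable (fun ξ => ((|ξ| ^ s : ℝ) : ℂ) * n ξ)) :
    ∃ p : ℝ → ℂ, Integrable p ∧ Integrable (fun ξ => ((|ξ| ^ s : ℝ) : ℂ) * p ξ) ∧
      ∀ x, EE p x = EE w x * EE n x := by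
  have hI := conv_int hw hn
  refine ⟨fun ξ => ∫ η, w (ξ - η) * n η, hI.integral_prod_left, ?_, ?_⟩
  · have h1 := (conv_int hw' hn).norm.add (conv_int hw hn').norm
    have h2 : Integrable (fun z : ℝ × ℝ => ((|z.1| ^ s : ℝ) : ℂ) * (w (z.1 - z.2) * n z.2))
        (volume.prod volume) := by
      refine h1.mono' (Measurable.aestronglyMeasurable (by fun_prop) |>.mul
        hI.aestronglyMeasurable) (Filter.Eventually.of_forall fun z => ?_)
      simp only [norm_mul, Pi.add_apply, Complex.norm_real]
      rw [Real.norm_of_nonneg (by positivity), Real.norm_of_nonneg (by positivity),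
        Real.norm_of_nonneg (by positivity)]
      have := mul_le_mul_of_nonneg_right (sub_rpow_le hs hs1 z.1 z.2)
        (show 0 ≤ ‖w (z.1 - z.2)‖ * ‖n z.2‖ by positivity)
      linarith
    refine h2.integral_prod_left.congr (Filter.Eventually.of_forall fun ξ => ?_)
    simp only [integral_const_mul]
  · intro x
    have h2 : Integrable (fun z : ℝ × ℝ => (w (z.1 - z.2) * n z.2) *
        Complex.exp (Complex.I * x * z.1)) (volume.prod volume) :=
      hI.mul_bdd (c := 1) (by fun_prop) (Filter.Eventually.of_forall fun z => by rw [norm_exp_I])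
    have e0 : EE (fun ξ => ∫ η, w (ξ - η) * n η) x =
        ∫ ξ, ∫ η, (w (ξ - η) * n η) * Complex.exp (Complex.I * x * ξ) := by
      unfold EE
      simp_rw [← integral_mul_const]
    rw [e0, integral_integral_swap (f := fun ξ η => (w (ξ - η) * n η) *
        Complex.exp (Complex.I * x * ξ)) h2]
    rw [show EE n x = ∫ η, n η * Complex.exp (Complex.I * x * η) from rfl, ← integral_const_mul]
    congr 1; ext η
    have : ∀ ξ : ℝ, w (ξ - η) * n η * Complex.exp (Complex.I * x * ξ)
        = (fun ζ : ℝ => w ζ * Complex.exp (Complex.I * x * ζ)) (ξ - η) *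
          (n η * Complex.exp (Complex.I * x * η)) := by
      intro ξ
      have : Complex.exp (Complex.I * x * ξ) = Complex.exp (Complex.I * x * (ξ - η : ℝ)) *
          Complex.exp (Complex.I * x * η) := by
        rw [← Complex.exp_add]; congr 1; push_cast; ring
      dsimp only
      rw [this]; ring
    simp_rw [this]
    rw [integral_mul_const, integral_sub_right_eq_self
      (fun ζ : ℝ => w ζ * Complex.exp (Complex.I * x * ζ)) η]
    rfl

lemma pow_integrable {m : ℝ → ℂ} (hm : Measurable m) {C : ℝ} (hC : 0 ≤ C) (h0 : ∀ ξ, ‖m ξ‖ ≤ C)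
    (h2 : ∀ ξ, |ξ| ^ 2 * ‖m ξ‖ ≤ C) {s : ℝ} (hs : -1 < s) (hs1 : s < 1) :
    Integrable (fun ξ => ((|ξ| ^ s : ℝ) : ℂ) * m ξ) := by
  refine ⟨Measurable.aestronglyMeasurable (by fun_prop), ?_⟩
  unfold HasFiniteIntegral
  have k1 := PP_near (α := s + 1) (by linarith) 1 one_pos 0
  have k2 := PP_far (γ := 2 - s) (by linarith) 1 one_pos 0
  have hmn : Measurable (fun y : ℝ => if |0 - y| < 1 then ENNReal.ofReal (|0 - y| ^ (s + 1 - 1)) else 0) :=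
    Measurable.ite (measurableSet_lt (by fun_prop) (by fun_prop)) (by fun_prop) (by fun_prop)
  have hmf : Measurable (fun y : ℝ => if |0 - y| < 1 then 0 else ENNReal.ofReal (|0 - y| ^ (-(2 - s)))) :=
    Measurable.ite (measurableSet_lt (by fun_prop) (by fun_prop)) (by fun_prop) (by fun_prop)
  have : ∫⁻ ξ, ‖((|ξ| ^ s : ℝ) : ℂ) * m ξ‖ₑ ≤ ∫⁻ ξ, ENNReal.ofReal C *
      ((if |0 - ξ| < 1 then ENNReal.ofReal (|0 - ξ| ^ (s + 1 - 1)) else 0) +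
      (if |0 - ξ| < 1 then 0 else ENNReal.ofReal (|0 - ξ| ^ (-(2 - s))))) := by
    refine lintegral_mono fun ξ => ?_
    rw [← ofReal_norm, norm_mul, Complex.norm_real, Real.norm_of_nonneg (by positivity)]
    simp only [zero_sub, abs_neg]
    split_ifs with h
    · rw [add_zero, ← ENNReal.ofReal_mul hC, mul_comm]
      apply ENNReal.ofReal_le_ofReal
      simp only [add_sub_cancel_right]
      gcongr; exact h0 ξ
    · rw [zero_add, ← ENNReal.ofReal_mul hC]
      apply ENNReal.ofReal_le_ofReal
      have hp : 0 < |ξ| := by linarith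
      rw [show -(2 - s) = s - 2 by ring, Real.rpow_sub hp, Real.rpow_two, mul_div_assoc', le_div_iff₀ (by positivity)]
      nlinarith [mul_le_mul_of_nonneg_left (h2 ξ) (Real.rpow_nonneg hp.le s)]
  refine this.trans_lt ?_
  rw [lintegral_const_mul' _ _ (by simp), lintegral_add_left hmn, k1, k2]
  exact ENNReal.mul_lt_top (by simp) (by simp)

/-- normalized Fourier transform -/
noncomputable def mS (f : ℝ → ℂ) (ξ : ℝ) : ℂ := ((2 * π)⁻¹ : ℝ) * FT f ξ

lemma absGrad_eq (s : ℝ) (f : ℝ → ℂ) :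
    absGrad s f = EE (fun ξ => ((|ξ| ^ s : ℝ) : ℂ) * mS f ξ) := by
  ext x
  unfold absGrad EE mS
  rw [Complex.real_smul, ← integral_const_mul]
  congr 1; ext ξ
  rw [Complex.real_smul]; ring

open FourierTransform in
lemma FT_eq (f : SchwartzMap ℝ ℂ) (ξ : ℝ) : FT f ξ = (𝓕 f : SchwartzMap ℝ ℂ) ((2 * π)⁻¹ * ξ) := by
  rw [SchwartzMap.fourier_coe, Real.fourier_real_eq_integral_exp_smul, FT]
  congr 1; ext x
  rw [smul_eq_mul, mul_comm]
  congr 2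
  push_cast
  have : (π : ℂ) ≠ 0 := by exact_mod_cast pi_ne_zero
  field_simp

open FourierTransform in
lemma mS_pow_int (f : SchwartzMap ℝ ℂ) {s : ℝ} (hs : -1 < s) (hs1 : s < 1) :
    Integrable (fun ξ => ((|ξ| ^ s : ℝ) : ℂ) * mS f ξ) := by
  obtain ⟨C0, hC0, h0⟩ := (𝓕 f : SchwartzMap ℝ ℂ).decay 0 0
  obtain ⟨C2, hC2, h2⟩ := (𝓕 f : SchwartzMap ℝ ℂ).decay 2 0
  simp only [pow_zero, one_mul, norm_iteratedFDeriv_zero] at h0 h2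
  have hmS : ∀ ξ, mS f ξ = ((2 * π)⁻¹ : ℝ) * (𝓕 f : SchwartzMap ℝ ℂ) ((2 * π)⁻¹ * ξ) := by
    intro ξ; rw [mS, FT_eq]
  have hc : Continuous (𝓕 f : SchwartzMap ℝ ℂ) := (𝓕 f : SchwartzMap ℝ ℂ).continuous
  refine pow_integrable (C := (2 * π)⁻¹ * C0 + (2 * π) * C2) ?_ (by positivity) ?_ ?_ hs hs1
  · refine Continuous.measurable ?_
    rw [show mS f = _ from funext hmS]
    fun_prop
  · intro ξ
    rw [hmS, norm_mul, Complex.norm_real, Real.norm_of_nonneg (by positivity)]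
    have := mul_le_mul_of_nonneg_left (h0 ((2 * π)⁻¹ * ξ)) (show 0 ≤ (2 * π)⁻¹ by positivity)
    have : 0 ≤ 2 * π * C2 := by positivity
    linarith
  · intro ξ
    rw [hmS, norm_mul, Complex.norm_real, Real.norm_of_nonneg (by positivity)]
    have h3 := mul_le_mul_of_nonneg_left (h2 ((2 * π)⁻¹ * ξ)) (show 0 ≤ 2 * π by positivity)
    rw [norm_mul, Real.norm_of_nonneg (by positivity), mul_pow, Real.norm_eq_abs] at h3
    have : 0 ≤ (2 * π)⁻¹ * C0 := by positivity
    refine le_trans (le_of_eq ?_) (h3.trans (by linarith))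
    field_simp

lemma mS_int (f : SchwartzMap ℝ ℂ) : Integrable (mS f) := by
  have := mS_pow_int f (s := 0) (by norm_num) (by norm_num)
  simpa using this

open FourierTransform in
lemma mS_inv (f : SchwartzMap ℝ ℂ) : EE (mS f) = f := by
  ext x
  have h1 : (𝓕⁻ (𝓕 f : SchwartzMap ℝ ℂ) : SchwartzMap ℝ ℂ) x = f x := by
    rw [FourierTransform.fourierInv_fourier_eq]
  rw [← h1, SchwartzMap.fourierInv_coe, Real.fourierInv_eq', EE]
  have h2 := Measure.integral_comp_mul_left (fun v : ℝ =>
    Complex.exp (((2 * π * inner ℝ v x : ℝ) : ℂ) * Complex.I) • (𝓕 f : SchwartzMap ℝ ℂ) v) (2 * π)⁻¹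
  rw [inv_inv, abs_of_pos (by positivity)] at h2
  have h3 : ∫ v : ℝ, Complex.exp (((2 * π * inner ℝ v x : ℝ) : ℂ) * Complex.I) •
      (𝓕 f : SchwartzMap ℝ ℂ) v = ((2 * π)⁻¹ : ℝ) • ∫ ξ : ℝ, (fun v : ℝ =>
      Complex.exp (((2 * π * inner ℝ v x : ℝ) : ℂ) * Complex.I) •
        (𝓕 f : SchwartzMap ℝ ℂ) v) ((2 * π)⁻¹ * ξ) := by
    rw [h2, smul_smul, inv_mul_cancel₀ (by positivity), one_smul]
  rw [h3, Complex.real_smul, ← integral_const_mul]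
  congr 1; ext ξ
  dsimp only
  rw [mS, FT_eq, smul_eq_mul]
  have : Complex.I * x * ξ = ((2 * π * inner ℝ ((2 * π)⁻¹ * ξ) x : ℝ) : ℂ) * Complex.I := by
    have : (π : ℂ) ≠ 0 := by exact_mod_cast pi_ne_zero
    simp
    field_simp
  rw [this]; ring

lemma schwartz_mul (f g : SchwartzMap ℝ ℂ) : ∃ p : SchwartzMap ℝ ℂ, ∀ x, p x = f x * g x := by
  refine ⟨SchwartzMap.smulLeftCLM ℂ f g, fun x => ?_⟩
  rw [SchwartzMap.smulLeftCLM_apply_apply f.hasTemperateGrowth, smul_eq_mul]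

lemma ae_ne (a : ℝ) : ∀ᵐ z : ℝ, z ≠ a := by simp [ae_iff, measure_singleton]

lemma pow_cancel (s t : ℝ) (hst : s + t = 0) (m : ℝ → ℂ) :
    (fun ξ => ((|ξ| ^ s : ℝ) : ℂ) * (((|ξ| ^ t : ℝ) : ℂ) * m ξ)) =ᵐ[volume] m := by
  filter_upwards [ae_ne 0] with ξ hξ
  have hp : 0 < |ξ| := abs_pos.2 hξ
  have : |ξ| ^ s * |ξ| ^ t = 1 := by rw [← Real.rpow_add hp, hst, Real.rpow_zero]
  have h2 : ((|ξ| ^ s : ℝ) : ℂ) * ((|ξ| ^ t : ℝ) : ℂ) = 1 := by exact_mod_cast this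
  rw [← mul_assoc, h2, one_mul]

lemma absGrad_meas (f : SchwartzMap ℝ ℂ) {s : ℝ} (hs : -1 < s) (hs1 : s < 1) :
    Measurable (fun x => ‖absGrad s f x‖ₑ) := by
  rw [absGrad_eq]
  exact EE_enorm_meas (mS_pow_int f hs hs1)

theorem g_bounds : ∃ C : ℝ≥0, ∀ g : SchwartzMap ℝ ℂ,
    (∀ x, ‖g x‖ₑ ≤ C * RI (3/8) (fun y => ‖absGrad (3/8) g y‖ₑ) x) ∧
    (∀ x y, RI (3/8) (fun y => ‖absGrad (3/8) g y‖ₑ) x < ⊤ →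
      RI (3/8) (fun y => ‖absGrad (3/8) g y‖ₑ) y < ⊤ →
      ‖g x - g y‖ₑ ≤ C * (ENNReal.ofReal (|x - y| ^ (3/16 : ℝ)) *
        (RI (3/16) (fun y => ‖absGrad (3/8) g y‖ₑ) x
          + RI (3/16) (fun y => ‖absGrad (3/8) g y‖ₑ) y))) := by
  obtain ⟨C, hC⟩ := riesz_bounds (β := 3/8) (σ := 3/16) (by norm_num) (by norm_num) (by norm_num)
    (by norm_num)
  refine ⟨C, fun g => ?_⟩
  have hc := pow_cancel (-(3/8)) (3/8) (by norm_num) (mS g)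
  have h1 := hC (fun ξ => ((|ξ| ^ (3/8 : ℝ) : ℝ) : ℂ) * mS g ξ)
    (mS_pow_int g (by norm_num) (by norm_num)) ((mS_int g).congr hc.symm)
  rw [EE_congr hc, mS_inv, ← absGrad_eq, show (3/8 - 3/16 : ℝ) = 3/16 by norm_num] at h1
  exact h1

lemma RI_fin {b : ℝ → ℝ≥0∞} (hb : Measurable b) (hbf : NN 2 b < ⊤) : ∀ᵐ x, RI (3/8) b x < ⊤ := by
  obtain ⟨C, -, hC⟩ := HLS (3/8) 2 8 (by norm_num) (by norm_num) (by norm_num) (by norm_num)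
  have h1 : NN 8 (RI (3/8) b) < ⊤ := (hC b hb).trans_lt (ENNReal.mul_lt_top (by simp) hbf)
  unfold NN at h1
  have h2 : ∫⁻ x, RI (3/8) b x ^ (8:ℝ) ≠ ⊤ := by
    intro h
    rw [h, ENNReal.top_rpow_of_pos (by norm_num)] at h1
    exact lt_irrefl _ h1
  have := ae_lt_top ((RI_meas (3/8) hb).pow_const 8) h2
  filter_upwards [this] with x hx
  by_contra h
  have : RI (3/8) b x = ⊤ := by simpa using h
  rw [this, ENNReal.top_rpow_of_pos (by norm_num)] at hx
  exact lt_irrefl _ hx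

lemma RI_mono_ae (α : ℝ) {u v : ℝ → ℝ≥0∞} (h : ∀ᵐ x, u x ≤ v x) (x : ℝ) : RI α u x ≤ RI α v x := by
  unfold RI
  refine lintegral_mono_ae ?_
  filter_upwards [h] with y hy
  gcongr

lemma kstar_bound {a b c : ℝ → ℝ≥0∞} (ha : Measurable a) (hb : Measurable b) (hc : Measurable c)
    {g h : ℝ → ℂ} {C : ℝ≥0}
    (hg : ∀ x, ‖g x‖ₑ ≤ C * RI (3/8) b x) (hh : ∀ x, ‖h x‖ₑ ≤ C * RI (3/8) c x)
    (hg2 : ∀ x y, RI (3/8) b x < ⊤ → RI (3/8) b y < ⊤ →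
      ‖g x - g y‖ₑ ≤ C * (ENNReal.ofReal (|x - y| ^ (3/16 : ℝ)) *
        (RI (3/16) b x + RI (3/16) b y)))
    (hh2 : ∀ x y, RI (3/8) c x < ⊤ → RI (3/8) c y < ⊤ →
      ‖h x - h y‖ₑ ≤ C * (ENNReal.ofReal (|x - y| ^ (3/16 : ℝ)) *
        (RI (3/16) c x + RI (3/16) c y)))
    (hbf : ∀ᵐ x, RI (3/8) b x < ⊤) (hcf : ∀ᵐ x, RI (3/8) c x < ⊤)
    {x : ℝ} (hbx : RI (3/8) b x < ⊤) (hcx : RI (3/8) c x < ⊤) :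
    ∫⁻ y, ENNReal.ofReal (|x - y| ^ (-1 - 1/8 : ℝ)) * (‖g y * h y - g x * h x‖ₑ * a y)
      ≤ (C * C : ℝ≥0∞) * KK a b c x := by
  have m1 := RI_meas (3/8) hb
  have m2 := RI_meas (3/16) hb
  have m3 := RI_meas (3/8) hc
  have m4 := RI_meas (3/16) hc
  have mk : Measurable (fun y : ℝ => ENNReal.ofReal (|x - y| ^ (1/16 - 1 : ℝ))) := by fun_prop
  have e : KK a b c x = ∫⁻ y, ((RI (3/8) c x * (RI (3/16) b x *
        (ENNReal.ofReal (|x - y| ^ (1/16 - 1 : ℝ)) * a y))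
      + RI (3/8) c x * (ENNReal.ofReal (|x - y| ^ (1/16 - 1 : ℝ)) * (RI (3/16) b y * a y)))
      + (RI (3/16) c x * (ENNReal.ofReal (|x - y| ^ (1/16 - 1 : ℝ)) * (RI (3/8) b y * a y))
      + ENNReal.ofReal (|x - y| ^ (1/16 - 1 : ℝ)) * (RI (3/8) b y * (RI (3/16) c y * a y)))) := by
    rw [lintegral_add_left (by fun_prop), lintegral_add_left (by fun_prop),
      lintegral_add_left (by fun_prop), lintegral_const_mul _ (by fun_prop),
      lintegral_const_mul _ (by fun_prop), lintegral_const_mul _ (by fun_prop),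
      lintegral_const_mul _ (by fun_prop)]
    rfl
  rw [e, ← lintegral_const_mul _ (by fun_prop)]
  refine lintegral_mono_ae ?_
  filter_upwards [hbf, hcf, ae_ne x] with y hby hcy hy
  have hp : 0 < |x - y| := abs_pos.2 (sub_ne_zero.2 hy.symm)
  have hk : ENNReal.ofReal (|x - y| ^ (1/16 - 1 : ℝ)) = ENNReal.ofReal (|x - y| ^ (-1 - 1/8 : ℝ)) *
      ENNReal.ofReal (|x - y| ^ (3/16 : ℝ)) := by
    rw [← ENNReal.ofReal_mul (by positivity), ← Real.rpow_add hp]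
    norm_num
  have hW : ‖g y * h y - g x * h x‖ₑ ≤ ‖g x - g y‖ₑ * ‖h x‖ₑ + ‖g y‖ₑ * ‖h x - h y‖ₑ := by
    rw [show g y * h y - g x * h x = -((g x - g y) * h x + g y * (h x - h y)) by ring, enorm_neg,
      ← enorm_mul, ← enorm_mul]
    exact enorm_add_le _ _
  have hW2 := hW.trans (add_le_add (mul_le_mul' (hg2 x y hbx hby) (hh x))
    (mul_le_mul' (hg y) (hh2 x y hcx hcy)))
  refine (mul_le_mul_right (mul_le_mul_left hW2 (a y)) _).trans (le_of_eq ?_)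
  rw [hk]
  ring

theorem A_bound : ∃ C : ℝ≥0, ∀ f g h : SchwartzMap ℝ ℂ,
    NN 2 (fun y => ‖absGrad (3/8) g y‖ₑ) < ⊤ → NN 2 (fun y => ‖absGrad (3/8) h y‖ₑ) < ⊤ →
    NN (4/3) (fun x => ‖absGrad (-(1/8)) (fun x => f x * g x * h x) x‖ₑ) ≤
      C * (NN 2 (fun y => ‖absGrad (-(1/8)) f y‖ₑ) * NN 2 (fun y => ‖absGrad (3/8) g y‖ₑ) *
        NN 2 (fun y => ‖absGrad (3/8) h y‖ₑ)) := by
  obtain ⟨C1, hC1⟩ := g_bounds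
  obtain ⟨C2, hC2⟩ := riesz_bounds (β := 1/8) (σ := 1/16) (by norm_num) (by norm_num) (by norm_num)
    (by norm_num)
  obtain ⟨C3, hC3⟩ := main_pos
  have hd := KD_ne (s := 1/8) (by norm_num) (by norm_num)
  set d : ℂ := ∫ t, KD (1/8) t with hd'
  refine ⟨C1 * C1 * C3 + C2 * (‖d⁻¹‖₊ * (C1 * C1)) * C3, fun f g h hbF hcF => ?_⟩
  have mb := absGrad_meas g (s := 3/8) (by norm_num) (by norm_num)
  have mc := absGrad_meas h (s := 3/8) (by norm_num) (by norm_num)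
  have ma := absGrad_meas f (s := -(1/8)) (by norm_num) (by norm_num)
  obtain ⟨hg, hg2⟩ := hC1 g
  obtain ⟨hh, hh2⟩ := hC1 h
  set a := fun y => ‖absGrad (-(1/8)) f y‖ₑ with ha
  set b := fun y => ‖absGrad (3/8) g y‖ₑ with hb
  set c := fun y => ‖absGrad (3/8) h y‖ₑ with hc
  have hbf := RI_fin mb hbF
  have hcf := RI_fin mc hcF
  obtain ⟨W, hW⟩ := schwartz_mul g h
  obtain ⟨P, hP⟩ := schwartz_mul f W
  have hPf : (fun x => f x * g x * h x) = P := by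
    ext x; rw [hP, hW]; ring
  rw [hPf]
  -- F and its symbol
  set n : ℝ → ℂ := fun ξ => ((|ξ| ^ (-(1/8) : ℝ) : ℝ) : ℂ) * mS f ξ with hn
  have hnI : Integrable n := mS_pow_int f (by norm_num) (by norm_num)
  have hnc := pow_cancel (1/8) (-(1/8)) (by norm_num) (mS f)
  have hnI' : Integrable (fun ξ => ((|ξ| ^ (1/8 : ℝ) : ℝ) : ℂ) * n ξ) := (mS_int f).congr hnc.symm
  have hF : absGrad (-(1/8)) f = EE n := absGrad_eq _ _
  obtain ⟨p, hp, hp', hpE⟩ := conv_EE (mS_int W) hnI (s := 1/8) (by norm_num) (by norm_num)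
    (mS_pow_int W (by norm_num) (by norm_num)) hnI'
  rw [mS_inv] at hpE
  -- the commutator symbol
  set m : ℝ → ℂ := fun ξ => mS P ξ - ((|ξ| ^ (1/8 : ℝ) : ℝ) : ℂ) * p ξ with hm
  have hmI : Integrable m := (mS_int P).sub hp'
  have hPI := mS_pow_int P (s := -(1/8)) (by norm_num) (by norm_num)
  have hme : (fun ξ => ((|ξ| ^ (-(1/8) : ℝ) : ℝ) : ℂ) * m ξ) =ᵐ[volume]
      fun ξ => ((|ξ| ^ (-(1/8) : ℝ) : ℝ) : ℂ) * mS P ξ - p ξ := by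
    filter_upwards [pow_cancel (-(1/8)) (1/8) (by norm_num) p] with ξ hξ
    simp only [hm]
    rw [mul_sub, hξ]
  have hmI' := (hPI.sub hp).congr hme.symm
  have hA : ∀ x, absGrad (-(1/8)) P x = W x * EE n x +
      EE (fun ξ => ((|ξ| ^ (-(1/8) : ℝ) : ℝ) : ℂ) * m ξ) x := by
    intro x
    rw [EE_congr hme, EE_sub hPI hp, hpE, absGrad_eq]; ring
  have hK : ∀ x, d * EE m x = ∫ y, (W y - W x) * EE n y * ((|x - y| ^ (-1 - 1/8 : ℝ) : ℝ) : ℂ) := by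
    intro x
    obtain ⟨i1, e1⟩ := lemmaD (s := 1/8) (by norm_num) (by norm_num) hnI hnI' x
    obtain ⟨i2, e2⟩ := lemmaD (s := 1/8) (by norm_num) (by norm_num) hp hp' x
    rw [EE_congr hnc, mS_inv] at e1
    rw [hm, EE_sub (mS_int P) hp', mS_inv, mul_sub, ← e2, hP]
    rw [← mul_assoc, ← e1, mul_comm _ (W x), ← integral_const_mul, ← integral_sub (i1.const_mul _) i2]
    congr 1; ext y
    rw [hpE, hpE]; ring
  have hKb : ∀ᵐ x, ‖EE m x‖ₑ ≤ (‖d⁻¹‖₊ * (C1 * C1) : ℝ≥0∞) * KK a b c x := by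
    filter_upwards [hbf, hcf] with x hbx hcx
    have : EE m x = d⁻¹ * (d * EE m x) := by field_simp
    rw [this, hK, enorm_mul, mul_assoc]
    refine mul_le_mul_right ((enorm_integral_le_lintegral_enorm _).trans ?_) _
    refine le_trans (le_of_eq ?_) (kstar_bound ma mb mc hg hh hg2 hh2 hbf hcf hbx hcx)
    congr 1; ext y
    rw [enorm_mul, enorm_mul, hW, hW, ha, hF, mul_comm]
    congr 1
    rw [← ofReal_norm, Complex.norm_real, Real.norm_of_nonneg (by positivity)]
  have mKK := KK_meas ma mb mc
  have mRK := RI_meas (1/8) mKK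
  have m1 := RI_meas (3/8) mb
  have m3 := RI_meas (3/8) mc
  have hpt : ∀ x, ‖absGrad (-(1/8)) P x‖ₑ ≤
      (C1 * C1 : ℝ≥0∞) * (RI (3/8) b x * (RI (3/8) c x * a x)) +
      (C2 * (‖d⁻¹‖₊ * (C1 * C1)) : ℝ≥0∞) * RI (1/8) (KK a b c) x := by
    intro x
    rw [hA]
    refine (enorm_add_le _ _).trans (add_le_add ?_ ?_)
    · rw [enorm_mul, hW, enorm_mul]
      refine (mul_le_mul_left (mul_le_mul' (hg x) (hh x)) _).trans (le_of_eq ?_)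
      rw [ha, hF]; ring
    · refine ((hC2 m hmI hmI').1 x).trans ?_
      rw [mul_assoc, ← RI_const_mul _ _ mKK]
      exact mul_le_mul_right (RI_mono_ae _ hKb x) _
  have := hC3 a b c ma mb mc
  calc _ ≤ _ := NN_mono_ae (4/3) (by norm_num) (Filter.Eventually.of_forall hpt)
    _ ≤ _ := NN_add (4/3) (by norm_num) (by fun_prop) (by fun_prop)
    _ ≤ (C1 * C1 : ℝ≥0∞) * (C3 * (NN 2 a * NN 2 b * NN 2 c)) +
      (C2 * (‖d⁻¹‖₊ * (C1 * C1)) : ℝ≥0∞) * (C3 * (NN 2 a * NN 2 b * NN 2 c)) := by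
        rw [NN_const_mul (by norm_num) _ (by fun_prop), NN_const_mul (by norm_num) _ (by fun_prop)]
        exact add_le_add (mul_le_mul_right this.1 _) (mul_le_mul_right this.2 _)
    _ = _ := by push_cast; ring

lemma zero_case {P : ℝ → ℂ} (h : P = 0) (s : ℝ) : absGrad s P = 0 := by
  subst h
  ext x
  simp [absGrad, FT]

lemma NN_eq (u : ℝ → ℂ) (p : ℝ≥0∞) (hp : p ≠ 0) (hpt : p ≠ ⊤) :
    eLpNorm u p volume = NN p.toReal (fun x => ‖u x‖ₑ) := by
  rw [eLpNorm_eq_lintegral_rpow_enorm_toReal hp hpt, NN]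

/-- Paraproduct estimate:
`‖|∇|^{-1/8}(fgh)‖_{L^{4/3}} ≲ ‖|∇|^{-1/8}f‖_{L²} ‖|∇|^{3/8}g‖_{L²} ‖|∇|^{3/8}h‖_{L²}`
for Schwartz functions. -/
theorem stmt6 : ∃ C > 0, ∀ f g h : SchwartzMap ℝ ℂ,
    eLpNorm (absGrad (-(1 / 8)) (fun x => f x * g x * h x)) (4 / 3) volume ≤
      ENNReal.ofReal C * eLpNorm (absGrad (-(1 / 8)) (fun x => f x)) 2 volume *
        eLpNorm (absGrad (3 / 8) (fun x => g x)) 2 volume *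
        eLpNorm (absGrad (3 / 8) (fun x => h x)) 2 volume := by
  obtain ⟨C, hC⟩ := A_bound
  obtain ⟨C1, hC1⟩ := g_bounds
  refine ⟨C + 1, by positivity, fun f g h => ?_⟩
  have hcont : ∀ (f : SchwartzMap ℝ ℂ) {s : ℝ}, -1 < s → s < 1 → Continuous (absGrad s f) := by
    intro f s hs hs1
    rw [absGrad_eq]; exact EE_continuous (mS_pow_int f hs hs1)
  have hz : ∀ (f : SchwartzMap ℝ ℂ) {s : ℝ}, -1 < s → s < 1 →
      eLpNorm (absGrad s f) 2 volume = 0 → absGrad s f = 0 := by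
    intro f s hs hs1 h0
    rw [eLpNorm_eq_zero_iff (hcont f hs hs1).aestronglyMeasurable (by norm_num)] at h0
    exact (hcont f hs hs1).ae_eq_iff_eq volume continuous_zero |>.1 h0
  have hzg : ∀ g : SchwartzMap ℝ ℂ, eLpNorm (absGrad (3/8) g) 2 volume = 0 → ∀ x, g x = 0 := by
    intro g h0 x
    have h1 := hz g (by norm_num) (by norm_num) h0
    have h2 := (hC1 g).1 x
    rw [h1] at h2
    simpa [RI] using h2
  have hzf : eLpNorm (absGrad (-(1/8)) f) 2 volume = 0 → ∀ x, f x = 0 := by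
    intro h0 x
    have h1 := hz f (by norm_num) (by norm_num) h0
    have hnc := pow_cancel (1/8) (-(1/8)) (by norm_num) (mS f)
    have e := (lemmaD (s := 1/8) (by norm_num) (by norm_num)
      (mS_pow_int f (s := -(1/8)) (by norm_num) (by norm_num)) ((mS_int f).congr hnc.symm) x).2
    rw [EE_congr hnc, mS_inv, ← absGrad_eq, h1] at e
    simp only [Pi.zero_apply, sub_zero, zero_mul, integral_zero] at e
    rcases mul_eq_zero.1 e.symm with h | h
    · exact absurd h (KD_ne (by norm_num) (by norm_num))
    · exact h
  have hzero : (∀ x, f x * g x * h x = 0) →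
      eLpNorm (absGrad (-(1 / 8)) (fun x => f x * g x * h x)) (4 / 3) volume = 0 := by
    intro hx
    rw [zero_case (funext hx)]
    simp
  by_cases h1 : eLpNorm (absGrad (-(1/8)) f) 2 volume = 0
  · rw [hzero fun x => by rw [hzf h1 x]; ring]; exact zero_le
  by_cases h2 : eLpNorm (absGrad (3/8) g) 2 volume = 0
  · rw [hzero fun x => by rw [hzg g h2 x]; ring]; exact zero_le
  by_cases h3 : eLpNorm (absGrad (3/8) h) 2 volume = 0
  · rw [hzero fun x => by rw [hzg h h3 x]; ring]; exact zero_le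
  have hC0 : ENNReal.ofReal ((C : ℝ) + 1) ≠ 0 := by
    rw [Ne, ENNReal.ofReal_eq_zero, not_le]; positivity
  by_cases h4 : eLpNorm (absGrad (3/8) g) 2 volume = ⊤
  · have : ENNReal.ofReal ((C : ℝ) + 1) * eLpNorm (absGrad (-(1 / 8)) (fun x => f x)) 2 volume *
        eLpNorm (absGrad (3 / 8) (fun x => g x)) 2 volume *
        eLpNorm (absGrad (3 / 8) (fun x => h x)) 2 volume = ⊤ := by
      rw [h4, ENNReal.mul_top (mul_ne_zero hC0 h1), ENNReal.top_mul h3]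
    rw [this]; exact le_top
  by_cases h5 : eLpNorm (absGrad (3/8) h) 2 volume = ⊤
  · have : ENNReal.ofReal ((C : ℝ) + 1) * eLpNorm (absGrad (-(1 / 8)) (fun x => f x)) 2 volume *
        eLpNorm (absGrad (3 / 8) (fun x => g x)) 2 volume *
        eLpNorm (absGrad (3 / 8) (fun x => h x)) 2 volume = ⊤ := by
      rw [h5, ENNReal.mul_top (mul_ne_zero (mul_ne_zero hC0 h1) h2)]
    rw [this]; exact le_top
  have t2 : (2 : ℝ≥0∞).toReal = 2 := by simp
  have t43 : (4 / 3 : ℝ≥0∞).toReal = 4 / 3 := by simp [ENNReal.toReal_div]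
  have q43 : (4 / 3 : ℝ≥0∞) ≠ ⊤ := ENNReal.div_ne_top (by simp) (by simp)
  have q430 : (4 / 3 : ℝ≥0∞) ≠ 0 := by simp [ENNReal.div_eq_zero_iff]
  have key := hC f g h
  rw [NN_eq _ _ (by norm_num) (by norm_num), t2] at h4 h5
  rw [NN_eq _ _ q430 q43, NN_eq _ 2 (by norm_num) (by norm_num),
    NN_eq _ 2 (by norm_num) (by norm_num), NN_eq _ 2 (by norm_num) (by norm_num), t2, t43]
  refine (key (lt_top_iff_ne_top.2 h4) (lt_top_iff_ne_top.2 h5)).trans ?_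
  rw [mul_assoc (ENNReal.ofReal _ * _), mul_assoc (ENNReal.ofReal _), ← mul_assoc (NN 2 _)]
  refine mul_le_mul_left ?_ _
  rw [← ENNReal.ofReal_coe_nnreal]
  exact ENNReal.ofReal_le_ofReal (by linarith)
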